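/- arXiv:2408.08523 — 2 statements merged into one kernel-verified Lean document; each statement's English description precedes it below -/
import Mathlib

section
/- For every sufficiently small γ > 0 there exists β0 > 0 such that for every β ∈ (0, β0) there exists n0 ∈ ℕ such that the following holds for all n ≥ n0. Let H be a balanced 4-partite 4-graph with vertex classes V1, V2, V3, V4, each of size n, such that d_H({x,y}) ≥ (1/2 + γ)n² for every x ∈ V1 and every y ∈ V2 ∪ V3 ∪ V4. Then H has a matching M with |M| ≤ γ⁶ n such that for every balanced subset S ⊆ V(H) \ V(M) with |S| ≤ β n, the induced subhypergraph H[S ∪ V(M)] has a perfect matching. -/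
open Finset

/-- The number of edges of `E` containing both vertices `x` and `y`. -/
def hdeg2 {α : Type} [DecidableEq α] (E : Finset (Finset α)) (x y : α) : ℕ :=
  (E.filter (fun e => x ∈ e ∧ y ∈ e)).card

/-- `E` is the edge set of a 4-partite 4-graph with classes `V1, V2, V3, V4`. -/
def IsPartite4 {α : Type} [DecidableEq α] (V1 V2 V3 V4 : Finset α)
    (E : Finset (Finset α)) : Prop :=
  ∀ e ∈ E, e ⊆ V1 ∪ V2 ∪ V3 ∪ V4 ∧ (e ∩ V1).card = 1 ∧ (e ∩ V2).card = 1 ∧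
    (e ∩ V3).card = 1 ∧ (e ∩ V4).card = 1


open Classical in
lemma greedy_abs {Ω 𝒯 : Type} [Fintype Ω] [Fintype 𝒯] [Nonempty 𝒯] (good : Ω → Prop)
    (conf : Ω → Ω → Prop) (ab : Ω → 𝒯 → Prop) (c N K : ℝ) (m : ℕ) (hN : 0 < N) (hc : 0 < c)
    (hK : 0 ≤ K)
    (hΩ : (Fintype.card Ω : ℝ) ≤ N)
    (hsymm : ∀ a b, conf a b → conf b a) (hrefl : ∀ a, conf a a)
    (hconf : ∀ a, ((univ.filter (fun b => conf a b)).card : ℝ) ≤ K)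
    (hab : ∀ t, c * N + m * K ≤ ((univ.filter (fun a => good a ∧ ab a t)).card : ℝ)) :
    ∀ k ≤ m, ∃ A : Finset Ω, A.card = k ∧ (∀ a ∈ A, good a) ∧
      (∀ a ∈ A, ∀ b ∈ A, a ≠ b → ¬ conf a b) ∧
      ∑ t : 𝒯, (1/2 : ℝ) ^ (A.filter (fun a => ab a t)).card
        ≤ Fintype.card 𝒯 * (1 - c / 2) ^ k := by
  intro k
  induction k with
  | zero => intro _; exact ⟨∅, by simp⟩
  | succ k ih =>
    intro hk
    obtain ⟨A, hAk, hAg, hAc, hAs⟩ := ih (by omega)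
    set w : 𝒯 → ℝ := fun t => (1/2 : ℝ) ^ (A.filter (fun a => ab a t)).card with hw
    have hw0 : ∀ t, 0 < w t := fun t => by simp only [hw]; positivity
    set B : Finset Ω := A.biUnion (fun a => univ.filter (fun b => conf a b)) with hB
    have hBc : (B.card : ℝ) ≤ m * K := by
      calc (B.card : ℝ) ≤ ((∑ a ∈ A, (univ.filter (fun b => conf a b)).card : ℕ) : ℝ) := by
            exact_mod_cast card_biUnion_le
        _ = ∑ a ∈ A, ((univ.filter (fun b => conf a b)).card : ℝ) := by push_cast; rfl
        _ ≤ ∑ a ∈ A, K := sum_le_sum (fun a _ => hconf a)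
        _ = k * K := by simp [hAk]
        _ ≤ m * K := by
            have : (k : ℝ) ≤ m := by exact_mod_cast (by omega)
            gcongr
    set P : Finset Ω := univ.filter (fun a => good a ∧ a ∉ B) with hP
    have hPt : ∀ t, c * N ≤ ((P.filter (fun a => ab a t)).card : ℝ) := by
      intro t
      have h1 : (univ.filter (fun a => good a ∧ ab a t)) ⊆ P.filter (fun a => ab a t) ∪ B := by
        intro a ha
        simp only [hP, mem_union, mem_filter, mem_univ, true_and] at ha ⊢
        tauto
      have h2 := (card_le_card h1).trans (card_union_le _ _)
      have h3 : ((univ.filter (fun a => good a ∧ ab a t)).card : ℝ)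
        ≤ (P.filter (fun a => ab a t)).card + B.card := by exact_mod_cast h2
      linarith [hab t]
    have hPN : (P.card : ℝ) ≤ N := by
      refine le_trans ?_ hΩ
      exact_mod_cast card_le_univ P
    have hPpos : 0 < P.card := by
      obtain ⟨t⟩ := ‹Nonempty 𝒯›
      have h1 := hPt t
      have h2 : (P.filter (fun a => ab a t)).card ≤ P.card := card_filter_le _ _
      have h3 : ((P.filter (fun a => ab a t)).card : ℝ) ≤ P.card := by exact_mod_cast h2
      have : 0 < c * N := by positivity
      exact_mod_cast (by linarith : (0:ℝ) < P.card)
    have hsum : ∑ a ∈ P, ∑ t, w t * (if ab a t then (1/2:ℝ) else 1)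
        ≤ ∑ a ∈ P, (1 - c/2) * ∑ t, w t := by
      rw [sum_comm, sum_const, nsmul_eq_mul]
      have : ∀ t, ∑ a ∈ P, w t * (if ab a t then (1/2:ℝ) else 1) ≤ w t * (P.card * (1 - c/2)) := by
        intro t
        rw [← mul_sum]
        apply mul_le_mul_of_nonneg_left _ (hw0 t).le
        have e : ∀ a, (if ab a t then (1/2:ℝ) else 1) = 1 - 1/2 * (if ab a t then 1 else 0) := by
          intro a; split_ifs <;> norm_num
        simp only [e]
        rw [sum_sub_distrib, ← mul_sum, sum_boole]
        simp only [sum_const, nsmul_eq_mul, mul_one]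
        have := hPt t
        have h2 : c * P.card ≤ c * N := by gcongr
        linarith
      calc _ ≤ ∑ t, w t * (P.card * (1 - c/2)) := sum_le_sum (fun t _ => this t)
        _ = _ := by rw [← sum_mul]; ring
    obtain ⟨a, haP, ha⟩ := exists_le_of_sum_le (card_pos.mp hPpos) hsum
    simp only [hP, mem_filter, mem_univ, true_and] at haP
    obtain ⟨hag, haB⟩ := haP
    have hnc : ∀ b ∈ A, ¬ conf b a := by
      intro b hb h
      exact haB (by simp only [hB, mem_biUnion, mem_filter, mem_univ, true_and]; exact ⟨b, hb, h⟩)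
    have haA : a ∉ A := fun h => hnc a h (hrefl a)
    refine ⟨insert a A, by rw [card_insert_of_notMem haA, hAk], ?_, ?_, ?_⟩
    · intro b hb
      rcases mem_insert.mp hb with rfl | hb
      · exact hag
      · exact hAg b hb
    · intro b hb d hd hne
      rcases mem_insert.mp hb with hb1 | hb1 <;> rcases mem_insert.mp hd with hd1 | hd1
      · exact absurd (hb1.trans hd1.symm) hne
      · exact fun h => hnc d hd1 (hsymm _ _ (hb1 ▸ h))
      · exact fun h => hnc b hb1 (hd1 ▸ h)
      · exact hAc b hb1 d hd1 hne
    · have hcle : 0 ≤ 1 - c / 2 := by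
        obtain ⟨t⟩ := ‹Nonempty 𝒯›
        have h1 := hPt t
        have h2 : (P.filter (fun a => ab a t)).card ≤ P.card := card_filter_le _ _
        have h3 : ((P.filter (fun a => ab a t)).card : ℝ) ≤ P.card := by exact_mod_cast h2
        have h4 : c * N ≤ 1 * N := by linarith
        have := le_of_mul_le_mul_right h4 hN
        linarith
      have e : ∀ t, (1/2 : ℝ) ^ ((insert a A).filter (fun a => ab a t)).card
          = w t * (if ab a t then (1/2:ℝ) else 1) := by
        intro t
        rw [filter_insert]
        split_ifs with h
        · rw [card_insert_of_notMem (by simp [haA]), pow_succ]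
        · simp [hw]
      rw [sum_congr rfl (fun t _ => e t)]
      calc _ ≤ (1 - c/2) * ∑ t, w t := ha
        _ ≤ (1 - c/2) * (Fintype.card 𝒯 * (1 - c / 2) ^ k) := by gcongr
        _ = _ := by ring

section core
variable {n : ℕ}

def Conf (a b : Fin 4 → Fin 4 → Fin n) : Prop := ∃ i i' j, a i j = b i' j

def Good (P : (Fin 4 → Fin n) → Prop) (a : Fin 4 → Fin 4 → Fin n) : Prop :=
  (∀ i, P (a i)) ∧ ∀ i i' j, i ≠ i' → a i j ≠ a i' j

def Abso (P : (Fin 4 → Fin n) → Prop) (a : Fin 4 → Fin 4 → Fin n) (t : Fin 4 → Fin n) : Prop :=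
  P (fun i => a i i) ∧ ∀ i, P (Function.update (a i) i (t i))

lemma card_off (i j : Fin 4) (S : Finset (Fin 4 → Fin 4 → Fin n))
    (h : ∀ a ∈ S, ∀ b ∈ S, (∀ p : Fin 4 × Fin 4, p ≠ (i, j) → a p.1 p.2 = b p.1 p.2) →
      a i j = b i j) : S.card ≤ n ^ 15 := by
  have : S.card ≤ (univ : Finset ({p : Fin 4 × Fin 4 // p ≠ (i,j)} → Fin n)).card := by
    apply card_le_card_of_injOn (fun a p => a p.1.1 p.1.2) (by simp)
    intro a ha b hb hab
    have h1 : ∀ p : Fin 4 × Fin 4, p ≠ (i, j) → a p.1 p.2 = b p.1 p.2 :=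
      fun p hp => congrFun hab ⟨p, hp⟩
    funext x y
    by_cases hxy : (x, y) = (i, j)
    · obtain ⟨rfl, rfl⟩ := Prod.mk.inj hxy
      exact h a ha b hb h1
    · exact h1 (x, y) hxy
  simpa [Fintype.card_subtype_compl] using this

open Classical in
lemma conf_count (a : Fin 4 → Fin 4 → Fin n) :
    (univ.filter (fun b => Conf a b)).card ≤ 64 * n ^ 15 := by
  have h1 : univ.filter (fun b => Conf a b) ⊆
      (univ : Finset (Fin 4 × Fin 4 × Fin 4)).biUnion
        (fun q => univ.filter (fun b => a q.1 q.2.2 = b q.2.1 q.2.2)) := by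
    intro b hb
    simp only [mem_filter, mem_univ, true_and, mem_biUnion] at hb ⊢
    obtain ⟨i, i', j, h⟩ := hb
    exact ⟨(i, i', j), h⟩
  refine (card_le_card h1).trans ((card_biUnion_le_card_mul _ _ (n^15) ?_).trans (by simp))
  rintro ⟨i, i', j⟩ -
  apply card_off i' j
  intro b hb b' hb' _
  simp only [mem_filter, mem_univ, true_and] at hb hb'
  rw [← hb, ← hb']

open Classical in
lemma degen_count :
    (univ.filter (fun a : Fin 4 → Fin 4 → Fin n =>
      ∃ i i' j, i ≠ i' ∧ a i j = a i' j)).card ≤ 64 * n ^ 15 := by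
  have h1 : (univ.filter (fun a : Fin 4 → Fin 4 → Fin n => ∃ i i' j, i ≠ i' ∧ a i j = a i' j)) ⊆
      (univ : Finset (Fin 4 × Fin 4 × Fin 4)).biUnion
        (fun q => univ.filter (fun b => q.1 ≠ q.2.1 ∧ b q.1 q.2.2 = b q.2.1 q.2.2)) := by
    intro b hb
    simp only [mem_filter, mem_univ, true_and, mem_biUnion] at hb ⊢
    obtain ⟨i, i', j, h⟩ := hb
    exact ⟨(i, i', j), h⟩
  refine (card_le_card h1).trans ((card_biUnion_le_card_mul _ _ (n^15) ?_).trans (by simp))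
  rintro ⟨i, i', j⟩ -
  apply card_off i' j
  intro b hb b' hb' h
  simp only [mem_filter, mem_univ, true_and] at hb hb'
  rw [← hb.2, ← hb'.2]
  exact h (i, j) (by simp [hb.1])

open Classical in
/-- pairs of fixed coordinates -/
lemma fix2_count (i k : Fin 4) (hik : i ≠ k) (u w : Fin n) :
    (univ.filter (fun e : Fin 4 → Fin n => e i = u ∧ e k = w)).card ≤ n ^ 2 := by
  have : (univ.filter (fun e : Fin 4 → Fin n => e i = u ∧ e k = w)).card
      ≤ (univ : Finset ({p : Fin 4 // p ∉ ({i, k} : Finset (Fin 4))} → Fin n)).card := by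
    apply card_le_card_of_injOn (fun a p => a p.1) (by simp)
    intro a ha b hb hab
    simp only [coe_filter, mem_univ, true_and, Set.mem_ofPred_eq] at ha hb
    funext x
    by_cases hx : x ∈ ({i, k} : Finset (Fin 4))
    · simp only [mem_insert, mem_singleton] at hx
      rcases hx with rfl | rfl
      · rw [ha.1, hb.1]
      · rw [ha.2, hb.2]
    · exact congrFun hab ⟨x, hx⟩
  refine this.trans ?_
  have h2 : Fintype.card {p : Fin 4 // p ∉ ({i, k} : Finset (Fin 4))} = 2 := by
    rw [Fintype.card_subtype_compl, Fintype.card_coe, card_pair hik]; rfl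
  rw [card_univ, Fintype.card_fun, h2, Fintype.card_fin]

open Classical in
lemma common_count (P : (Fin 4 → Fin n) → Prop) (γ : ℝ) (i k : Fin 4) (hik : i ≠ k)
    (hdeg : ∀ u w, (1/2 + γ) * n ^ 2 ≤
      ((univ.filter (fun e : Fin 4 → Fin n => e i = u ∧ e k = w ∧ P e)).card : ℝ)) (u x : Fin n) :
    2 * γ * n ^ 3 ≤ ((univ.filter (fun e : Fin 4 → Fin n =>
      e i = u ∧ P e ∧ P (Function.update e i x))).card : ℝ) := by
  have key : ∀ w : Fin n, 2 * γ * n ^ 2 ≤ (((univ.filter (fun e : Fin 4 → Fin n =>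
      e i = u ∧ P e ∧ P (Function.update e i x))).filter (fun e => e k = w)).card : ℝ) := by
    intro w
    have hA := hdeg u w
    have hB := hdeg x w
    set A := univ.filter (fun e : Fin 4 → Fin n => e i = u ∧ e k = w ∧ P e)
    set B := univ.filter (fun e : Fin 4 → Fin n => e i = x ∧ e k = w ∧ P e)
    set B' := univ.filter (fun e : Fin 4 → Fin n =>
      e i = u ∧ e k = w ∧ P (Function.update e i x)) with hB'
    have hBB : B.card ≤ B'.card := by
      apply card_le_card_of_injOn (fun e => Function.update e i u)
      · intro e he
        simp only [B, B', coe_filter, mem_univ, true_and, Set.mem_ofPred_eq] at he ⊢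
        obtain ⟨h1, h2, h3⟩ := he
        refine ⟨by simp, by simp [hik.symm, h2], ?_⟩
        rw [Function.update_idem, ← h1, Function.update_eq_self]
        exact h3
      · intro e he e' he' h
        simp only [B, coe_filter, mem_univ, true_and, Set.mem_ofPred_eq] at he he'
        have h' := congrArg (fun z => Function.update z i x) h
        simp only [Function.update_idem] at h'
        rwa [show Function.update e i x = e by rw [← he.1, Function.update_eq_self],
          show Function.update e' i x = e' by rw [← he'.1, Function.update_eq_self]] at h'
    have hU : (A ∪ B').card ≤ n ^ 2 := by
      refine (card_le_card ?_).trans (fix2_count i k hik u w)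
      intro e he
      simp only [A, B', mem_union, mem_filter, mem_univ, true_and] at he ⊢
      tauto
    have hI : A ∩ B' ⊆ ((univ.filter (fun e : Fin 4 → Fin n =>
      e i = u ∧ P e ∧ P (Function.update e i x))).filter (fun e => e k = w)) := by
      intro e he
      simp only [A, B', mem_inter, mem_filter, mem_univ, true_and] at he ⊢
      tauto
    have h1 := card_union_add_card_inter A B'
    have h2 := card_le_card hI
    have h1' : ((A ∪ B').card : ℝ) + (A ∩ B').card = A.card + B'.card := by exact_mod_cast h1
    have h2' : ((A ∩ B').card : ℝ) ≤ _ := Nat.cast_le.mpr h2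
    have h3' : ((A ∪ B').card : ℝ) ≤ (n:ℝ) ^ 2 := by exact_mod_cast hU
    have h4' : (B.card : ℝ) ≤ B'.card := by exact_mod_cast hBB
    linarith
  rw [card_eq_sum_card_fiberwise (f := fun e => e k) (t := univ) (by intro _ _; simp)]
  push_cast
  calc 2 * γ * (n:ℝ) ^ 3 = ∑ w : Fin n, 2 * γ * (n:ℝ) ^ 2 := by simp; ring
    _ ≤ _ := sum_le_sum (fun w _ => key w)

open Classical in
lemma edge_count (P : (Fin 4 → Fin n) → Prop) (γ : ℝ) (hγ : 0 < γ)
    (hdeg : ∀ u w, (1/2 + γ) * n ^ 2 ≤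
      ((univ.filter (fun e : Fin 4 → Fin n => e 0 = u ∧ e 1 = w ∧ P e)).card : ℝ)) :
    1 / 2 * (n : ℝ) ^ 4 ≤ ((univ.filter (fun e : Fin 4 → Fin n => P e)).card : ℝ) := by
  rw [card_eq_sum_card_fiberwise (f := fun e => (e 0, e 1)) (t := univ) (by intro _ _; simp)]
  push_cast
  calc 1 / 2 * (n:ℝ) ^ 4 = ∑ w : Fin n × Fin n, 1/2 * (n:ℝ) ^ 2 := by simp; ring
    _ ≤ _ := by
      apply sum_le_sum
      rintro ⟨u, w⟩ -
      have h1 := hdeg u w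
      have h2 : (0:ℝ) ≤ γ * (n:ℝ)^2 := by positivity
      have h3 : (univ.filter (fun e : Fin 4 → Fin n => e 0 = u ∧ e 1 = w ∧ P e)) =
        ((univ.filter (fun e : Fin 4 → Fin n => P e)).filter (fun e => (e 0, e 1) = (u, w))) := by
        ext e; simp; tauto
      rw [h3] at h1
      linarith

open Classical in
lemma abso_count (P : (Fin 4 → Fin n) → Prop) (γ : ℝ) (hγ : 0 < γ)
    (hdeg : ∀ i, i ≠ 0 → ∀ u w, (1/2 + γ) * n ^ 2 ≤
      ((univ.filter (fun e : Fin 4 → Fin n => e 0 = u ∧ e i = w ∧ P e)).card : ℝ))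
    (t : Fin 4 → Fin n) :
    8 * γ ^ 4 * n ^ 16 ≤
      ((univ.filter (fun a => Good P a ∧ Abso P a t)).card : ℝ) + 64 * n ^ 15 := by
  have hN : ∀ (i : Fin 4) (u x : Fin n), 2 * γ * n ^ 3 ≤ ((univ.filter (fun e : Fin 4 → Fin n =>
      e i = u ∧ P e ∧ P (Function.update e i x))).card : ℝ) := by
    intro i
    by_cases hi : i = 0
    · subst hi
      exact common_count P γ 0 1 (by decide) (hdeg 1 (by decide))
    · apply common_count P γ i 0 hi
      intro u w
      have := hdeg i hi w u
      have e : (univ.filter (fun e : Fin 4 → Fin n => e i = u ∧ e 0 = w ∧ P e)) =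
        (univ.filter (fun e : Fin 4 → Fin n => e 0 = w ∧ e i = u ∧ P e)) := by
        ext e; simp only [mem_filter]; tauto
      rw [e]; exact this
  have hE := edge_count P γ hγ (hdeg 1 (by decide))
  set Q := univ.filter (fun a : Fin 4 → Fin 4 → Fin n => (∀ i, P (a i)) ∧ Abso P a t) with hQ
  have hQc : 8 * γ ^ 4 * (n:ℝ) ^ 16 ≤ (Q.card : ℝ) := by
    rw [card_eq_sum_card_fiberwise (f := fun a i => a i i)
      (t := univ.filter (fun e : Fin 4 → Fin n => P e))
      (by intro a ha; simp [hQ] at ha ⊢; exact ha.2.1)]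
    push_cast
    have hf : ∀ f ∈ univ.filter (fun e : Fin 4 → Fin n => P e), (2 * γ * (n:ℝ) ^ 3) ^ 4 ≤
        ((Q.filter (fun a => (fun i => a i i) = f)).card : ℝ) := by
      intro f hf
      have hfP : P f := by simpa using hf
      have hsub : Fintype.piFinset (fun i => univ.filter (fun e : Fin 4 → Fin n =>
          e i = f i ∧ P e ∧ P (Function.update e i (t i)))) ⊆
          Q.filter (fun a => (fun i => a i i) = f) := by
        intro a ha
        simp only [Fintype.mem_piFinset, mem_filter, mem_univ, true_and, hQ] at ha ⊢
        have h0 : (fun i => a i i) = f := funext (fun i => (ha i).1)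
        refine ⟨⟨fun i => (ha i).2.1, ?_, fun i => (ha i).2.2⟩, h0⟩
        exact h0 ▸ hfP
      have h1 := card_le_card hsub
      rw [Fintype.card_piFinset] at h1
      refine le_trans ?_ (Nat.cast_le.mpr h1)
      push_cast
      calc (2 * γ * (n:ℝ) ^ 3) ^ 4 = ∏ i : Fin 4, (2 * γ * (n:ℝ) ^ 3) := by simp
        _ ≤ _ := prod_le_prod (fun _ _ => by positivity) (fun i _ => hN i (f i) (t i))
    refine le_trans ?_ (sum_le_sum hf)
    rw [sum_const, nsmul_eq_mul]
    calc 8 * γ ^ 4 * (n:ℝ) ^ 16 = (1/2 * (n:ℝ)^4) * (2 * γ * (n:ℝ) ^ 3) ^ 4 := by ring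
      _ ≤ _ := by gcongr
  have hsub : Q ⊆ univ.filter (fun a => Good P a ∧ Abso P a t) ∪
    (univ.filter (fun a : Fin 4 → Fin 4 → Fin n => ∃ i i' j, i ≠ i' ∧ a i j = a i' j)) := by
    intro a ha
    simp only [hQ, mem_filter, mem_univ, true_and, mem_union] at ha ⊢
    by_cases h : ∃ i i' j, i ≠ i' ∧ a i j = a i' j
    · exact Or.inr h
    · push Not at h
      exact Or.inl ⟨⟨ha.1, h⟩, ha.2⟩
  have h1 := ((card_le_card hsub).trans (card_union_le _ _)).trans
    (Nat.add_le_add_left degen_count _)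
  have h2 : (Q.card : ℝ) ≤ _ := Nat.cast_le.mpr h1
  push_cast at h2
  linarith

end core

section core2
variable {n : ℕ}

open Classical in
lemma core_lemma (γ : ℝ) (hγ : 0 < γ) (hγ1 : γ < 1 / 2) (β : ℝ) (hβ : β < γ ^ 10 / 100) :
    ∃ n0 : ℕ, ∀ n : ℕ, n0 ≤ n → ∀ P : (Fin 4 → Fin n) → Prop,
    (∀ i, i ≠ 0 → ∀ u w, (1/2 + γ) * n ^ 2 ≤
      ((univ.filter (fun e : Fin 4 → Fin n => e 0 = u ∧ e i = w ∧ P e)).card : ℝ)) →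
    ∃ A : Finset (Fin 4 → Fin 4 → Fin n), 4 * (A.card : ℝ) ≤ γ ^ 6 * n ∧ (∀ a ∈ A, Good P a) ∧
      (∀ a ∈ A, ∀ b ∈ A, a ≠ b → ¬ Conf a b) ∧
      ∀ t, β * n ≤ ((A.filter (fun a => Abso P a t)).card : ℝ) := by
  set b : ℝ := γ ^ 10 / 100 with hb
  have hb0 : 0 < b := by positivity
  have htend : ∀ᶠ k : ℕ in Filter.atTop, Real.exp 2 / b ^ 4 ≤
      Real.exp (b * k) / (b * k) ^ 4 := by
    have h1 : Filter.Tendsto (fun k : ℕ => b * (k : ℝ)) Filter.atTop Filter.atTop :=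
      Filter.Tendsto.const_mul_atTop hb0 tendsto_natCast_atTop_atTop
    exact ((Real.tendsto_exp_div_pow_atTop 4).comp h1).eventually_ge_atTop _
  obtain ⟨n1, hn1⟩ := Filter.eventually_atTop.mp htend
  refine ⟨max n1 (max 1 ⌈64 / γ ^ 4⌉₊), ?_⟩
  intro n hn P hdeg
  have hnn1 : n1 ≤ n := le_trans (le_max_left _ _) hn
  have hnpos : 1 ≤ n := le_trans (le_trans (le_max_left _ _) (le_max_right _ _)) hn
  have hn64 : 64 / γ ^ 4 ≤ (n : ℝ) :=
    Nat.ceil_le.mp (le_trans (le_trans (le_max_right _ _) (le_max_right _ _)) hn)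
  have hnR : (0:ℝ) < n := by exact_mod_cast hnpos
  have hg4 : 0 < γ ^ 4 := by positivity
  rw [div_le_iff₀ hg4] at hn64
  set m : ℕ := ⌊γ ^ 6 * n / 100⌋₊ with hm
  have hm1 : (m : ℝ) ≤ γ ^ 6 * n / 100 := Nat.floor_le (by positivity)
  have hm2 : γ ^ 6 * n / 100 < m + 1 := Nat.lt_floor_add_one _
  have h64 : γ ^ 6 ≤ γ ^ 4 := pow_le_pow_of_le_one hγ.le (by linarith) (by norm_num)
  have h64n : γ ^ 6 * n ≤ γ ^ 4 * n := by gcongr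
  have hn' : Nonempty (Fin n) := ⟨⟨0, hnpos⟩⟩
  obtain ⟨A, hAk, hAg, hAc, hAs⟩ := greedy_abs (Good P) Conf (Abso P) (4 * γ ^ 4) ((n:ℝ) ^ 16)
    (64 * (n:ℝ) ^ 15) m (by positivity) (by positivity) (by positivity)
    (by simp only [Fintype.card_fun, Fintype.card_fin]; push_cast; apply le_of_eq; ring)
    (by rintro a b ⟨i, i', j, h⟩; exact ⟨i', i, j, h.symm⟩)
    (fun a => ⟨0, 0, 0, rfl⟩)
    (fun a => by exact_mod_cast conf_count a)
    (by
      intro t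
      have h1 := abso_count P γ hγ hdeg t
      have h2 : 64 * ((m:ℝ) + 1) * (n:ℝ) ^ 15 ≤ (4 * γ ^ 4 * n) * (n:ℝ) ^ 15 := by
        apply mul_le_mul_of_nonneg_right _ (by positivity)
        linarith
      have h3 : (n:ℝ) ^ 16 = n * (n:ℝ) ^ 15 := by ring
      rw [h3] at h1 ⊢
      linarith) m le_rfl
  refine ⟨A, ?_, hAg, hAc, ?_⟩
  · rw [hAk]
    have : 0 ≤ γ ^ 6 * n := by positivity
    linarith
  intro t
  set X := (A.filter (fun a => Abso P a t)).card with hX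
  have h1 : (1/2 : ℝ) ^ X ≤ Fintype.card (Fin 4 → Fin n) * (1 - 4 * γ ^ 4 / 2) ^ m := by
    refine le_trans ?_ hAs
    exact single_le_sum (f := fun t => (1/2 : ℝ) ^ (A.filter (fun a => Abso P a t)).card)
      (fun _ _ => by positivity) (mem_univ t)
  have hsmall : γ ^ 4 ≤ 1 / 16 := by
    calc γ ^ 4 ≤ (1/2) ^ 4 := by gcongr
      _ = 1 / 16 := by norm_num
  have h2 : (1 - 4 * γ ^ 4 / 2) ^ m ≤ Real.exp (-(2 * γ ^ 4 * m)) := by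
    calc (1 - 4 * γ ^ 4 / 2) ^ m ≤ (Real.exp (-(2 * γ ^ 4))) ^ m := by
          apply pow_le_pow_left₀ (by linarith)
          have := Real.add_one_le_exp (-(2 * γ ^ 4))
          linarith
      _ = _ := by rw [← Real.exp_nat_mul]; congr 1; ring
  have h3 : Real.exp (-(X:ℝ)) ≤ (1/2 : ℝ) ^ X := by
    have : Real.exp (-1) ≤ 1/2 := by
      have h := Real.add_one_le_exp 1
      rw [Real.exp_neg, inv_eq_one_div]
      apply one_div_le_one_div_of_le (by norm_num)
      linarith
    calc Real.exp (-(X:ℝ)) = (Real.exp (-1)) ^ X := by rw [← Real.exp_nat_mul]; congr 1; ring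
      _ ≤ _ := by gcongr
  have h4 : (n:ℝ) ^ 4 * Real.exp 2 ≤ Real.exp (b * n) := by
    have := hn1 n hnn1
    rw [div_le_div_iff₀ (by positivity) (by positivity)] at this
    have h5 : ((n:ℝ) ^ 4 * Real.exp 2) * b ^ 4 ≤ Real.exp (b * n) * b ^ 4 := by
      rw [mul_pow] at this; linarith
    exact le_of_mul_le_mul_right h5 (by positivity)
  have h5 : -(2 * γ ^ 4 * m) ≤ 2 - 2 * (b * n) := by
    have : γ ^ 4 * (γ ^ 6 * n / 100) ≤ γ ^ 4 * (m + 1) := by gcongr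
    have e : γ ^ 4 * (γ ^ 6 * n / 100) = b * n := by rw [hb]; ring
    rw [e] at this
    linarith
  have h6 : Real.exp (-(X:ℝ)) ≤ Real.exp (-(b * n)) := by
    calc Real.exp (-(X:ℝ)) ≤ (n:ℝ) ^ 4 * (1 - 4 * γ ^ 4 / 2) ^ m := by
          refine h3.trans (h1.trans (le_of_eq ?_)); simp
      _ ≤ (n:ℝ) ^ 4 * Real.exp (2 - 2 * (b * n)) := by
          gcongr
          exact h2.trans (Real.exp_le_exp.mpr h5)
      _ = ((n:ℝ) ^ 4 * Real.exp 2) * Real.exp (- (2 * (b * n))) := by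
          rw [sub_eq_add_neg, Real.exp_add]; ring
      _ ≤ Real.exp (b * n) * Real.exp (- (2 * (b * n))) := by gcongr
      _ = _ := by rw [← Real.exp_add]; congr 1; ring
  have h7 := Real.exp_le_exp.mp h6
  have h8 : β * n ≤ b * n := by gcongr
  linarith

/-- The vertices of colour `j` in the absorbing matching and in the set to be absorbed. -/
def base (A : Finset (Fin 4 → Fin 4 → Fin n)) {s : ℕ} (T : Fin s → Fin 4 → Fin n) (j : Fin 4) :
    (A × Fin 4) ⊕ Fin s → Fin n :=
  Sum.elim (fun p => p.1.1 p.2 j) (fun l => T l j)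

open Classical in
lemma absorb_lemma (P : (Fin 4 → Fin n) → Prop) (A : Finset (Fin 4 → Fin 4 → Fin n))
    (hAg : ∀ a ∈ A, Good P a)
    (hAc : ∀ a ∈ A, ∀ b ∈ A, a ≠ b → ¬ Conf a b) (s : ℕ) (T : Fin s → Fin 4 → Fin n)
    (hT : ∀ j, Function.Injective (fun l => T l j))
    (hTA : ∀ l j, ∀ a ∈ A, ∀ i, T l j ≠ a i j)
    (hab : ∀ t, s ≤ (A.filter (fun a => Abso P a t)).card) :
    ∃ F : (A × Fin 4) ⊕ Fin s → Fin 4 → Fin n, (∀ x, P (F x)) ∧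
      (∀ j, Function.Injective (fun x => F x j)) ∧
      ∀ j, Set.range (fun x => F x j) = Set.range (base A T j) := by
  obtain ⟨g, hg, hgm⟩ := (all_card_le_biUnion_card_iff_exists_injective
    (fun l : Fin s => A.filter (fun a => Abso P a (T l)))).mp (by
      intro L
      rcases L.eq_empty_or_nonempty with rfl | ⟨l, hl⟩
      · simp
      · calc L.card ≤ s := by simpa using card_le_univ L
          _ ≤ _ := hab (T l)
          _ ≤ _ := card_le_card (subset_biUnion_of_mem (fun l : Fin s => A.filter (fun a => Abso P a (T l))) hl))
  have hgA : ∀ l, g l ∈ A := fun l => (mem_filter.mp (hgm l)).1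
  have hgB : ∀ l, Abso P (g l) (T l) := fun l => (mem_filter.mp (hgm l)).2
  -- the permutation
  let σ : Fin 4 → (A × Fin 4) ⊕ Fin s → (A × Fin 4) ⊕ Fin s := fun j x =>
    match x with
    | Sum.inl p => if h : p.2 = j ∧ ∃ l, g l = p.1.1 then Sum.inr h.2.choose else Sum.inl p
    | Sum.inr l => Sum.inl (⟨g l, hgA l⟩, j)
  have hσ1 : ∀ j l, σ j (Sum.inl (⟨g l, hgA l⟩, j)) = Sum.inr l := by
    intro j l
    have h : j = j ∧ ∃ l', g l' = g l := ⟨rfl, l, rfl⟩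
    have h2 : σ j (Sum.inl (⟨g l, hgA l⟩, j)) = Sum.inr h.2.choose := dif_pos h
    rw [h2, hg h.2.choose_spec]
  have hσ2 : ∀ j a i, ¬ (i = j ∧ ∃ l, g l = a.1) → σ j (Sum.inl (a, i)) = Sum.inl (a, i) := by
    intro j a i h
    exact dif_neg h
  have hσs : ∀ j, Function.Surjective (σ j) := by
    rintro j (⟨a, i⟩ | l)
    · by_cases h : i = j ∧ ∃ l, g l = a.1
      · obtain ⟨rfl, l, hl⟩ := h
        refine ⟨Sum.inr l, ?_⟩
        have e : (⟨g l, hgA l⟩ : A) = a := Subtype.ext hl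
        subst e
        rfl
      · exact ⟨Sum.inl (a, i), hσ2 j a i h⟩
    · exact ⟨Sum.inl (⟨g l, hgA l⟩, j), hσ1 j l⟩
  have hσi : ∀ j, Function.Injective (σ j) := fun j => Finite.injective_iff_surjective.mpr (hσs j)
  have hbi : ∀ j, Function.Injective (base A T j) := by
    rintro j (⟨a, i⟩ | l) (⟨a', i'⟩ | l') h
    · change a.1 i j = a'.1 i' j at h
      have haa : a = a' := by
        by_contra hne
        exact hAc a a.2 a' a'.2 (fun h => hne (Subtype.ext h)) ⟨i, i', j, h⟩
      subst haa
      have : i = i' := by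
        by_contra hne
        exact (hAg a a.2).2 i i' j hne h
      rw [this]
    · exact absurd h.symm (hTA l' j a a.2 i)
    · exact absurd h (hTA l j a' a'.2 i')
    · rw [hT j h]
  refine ⟨fun x j => base A T j (σ j x), ?_, fun j => (hbi j).comp (hσi j),
    fun j => (hσs j).range_comp _⟩
  rintro (⟨a, i⟩ | l)
  · by_cases h : ∃ l, g l = a.1
    · obtain ⟨l, hl⟩ := h
      have e : a = ⟨g l, hgA l⟩ := Subtype.ext hl.symm
      subst e
      convert (hgB l).2 i using 1
      funext j
      by_cases hij : i = j
      · subst hij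
        beta_reduce
        rw [hσ1]; simp [base]
      · beta_reduce
        rw [hσ2 _ _ _ (fun h => hij h.1)]
        rw [Function.update_of_ne (Ne.symm hij)]
        rfl
    · convert (hAg a a.2).1 i using 1
      funext j
      beta_reduce
      rw [hσ2 _ _ _ (fun h' => h h'.2)]
      rfl
  · exact (hgB l).1

end core2

lemma transfer_lemma (γ : ℝ) (hγ : 0 < γ) (hγ1 : γ < 1 / 2) (β : ℝ) (hβ0 : 0 < β)
    (hβ : β < γ ^ 10 / 100) :
    ∃ n0 : ℕ, ∀ n : ℕ, n0 ≤ n → ∀ (α : Type) [DecidableEq α] (W : Fin 4 → Finset α),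
      (∀ i j, i ≠ j → Disjoint (W i) (W j)) → (∀ i, (W i).card = n) →
      ∀ E : Finset (Finset α),
        (∀ e ∈ E, e ⊆ univ.biUnion W ∧ ∀ j, (e ∩ W j).card = 1) →
        (∀ j, j ≠ 0 → ∀ x ∈ W 0, ∀ y ∈ W j, ((1 : ℝ) / 2 + γ) * n ^ 2 ≤
          ((E.filter (fun e => x ∈ e ∧ y ∈ e)).card : ℝ)) →
        ∃ M : Finset (Finset α),
          M ⊆ E ∧
          (∀ e ∈ M, ∀ f ∈ M, e ≠ f → Disjoint e f) ∧
          (M.card : ℝ) ≤ γ ^ 6 * n ∧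
          ∀ S : Finset α,
            S ⊆ univ.biUnion W →
            Disjoint S (M.biUnion id) →
            (∀ j, (S ∩ W j).card = (S ∩ W 0).card) →
            (S.card : ℝ) ≤ β * n →
            ∃ M' : Finset (Finset α),
              M' ⊆ E.filter (fun e => e ⊆ S ∪ M.biUnion id) ∧
              (∀ e ∈ M', ∀ f ∈ M', e ≠ f → Disjoint e f) ∧
              (∀ v ∈ S ∪ M.biUnion id, ∃ e ∈ M', v ∈ e) := by
  obtain ⟨n0, hn0⟩ := core_lemma γ hγ hγ1 β hβ
  refine ⟨n0, ?_⟩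
  intro n hn α _ W hW hWn E hE hdeg
  let φ : ∀ j, Fin n ≃ W j := fun j => ((W j).equivFinOfCardEq (hWn j)).symm
  let v : Fin 4 → Fin n → α := fun j x => (φ j x).1
  have hvW : ∀ j x, v j x ∈ W j := fun j x => (φ j x).2
  have hvs : ∀ j, ∀ y ∈ W j, ∃ x, v j x = y := by
    intro j y hy
    refine ⟨(φ j).symm ⟨y, hy⟩, ?_⟩
    simp [v]
  have hWu : ∀ i j y, y ∈ W i → y ∈ W j → i = j := by
    intro i j y hi hj
    by_contra hne
    exact (disjoint_left.mp (hW i j hne)) hi hj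
  have hvi : ∀ j x j' x', v j x = v j' x' → j = j' ∧ x = x' := by
    intro j x j' x' h
    have hj : j = j' := hWu j j' (v j x) (hvW j x) (h ▸ hvW j' x')
    subst hj
    exact ⟨rfl, (φ j).injective (Subtype.ext h)⟩
  let ψ : (Fin 4 → Fin n) → Finset α := fun e => univ.image (fun j => v j (e j))
  have hψ : ∀ e y, y ∈ ψ e ↔ ∃ j, v j (e j) = y := by
    intro e y; simp [ψ]
  have hψv : ∀ e j x, v j x ∈ ψ e ↔ e j = x := by
    intro e j x
    rw [hψ]
    constructor
    · rintro ⟨j', h⟩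
      obtain ⟨hj, hx⟩ := hvi _ _ _ _ h
      subst hj
      exact hx
    · rintro rfl; exact ⟨j, rfl⟩
  have hψd : ∀ e f, (∀ j, e j ≠ f j) → Disjoint (ψ e) (ψ f) := by
    intro e f h
    rw [disjoint_left]
    intro y hy hy'
    obtain ⟨j, rfl⟩ := (hψ e y).mp hy
    exact h j ((hψv f j _).mp hy').symm
  have hEψ : ∀ e ∈ E, ∃ p, ψ p = e := by
    intro e he
    obtain ⟨h1, h2⟩ := hE e he
    have h3 : ∀ j, ∃ x, e ∩ W j = {v j x} := by
      intro j
      obtain ⟨y, hy⟩ := card_eq_one.mp (h2 j)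
      have : y ∈ e ∩ W j := by rw [hy]; simp
      obtain ⟨x, hx⟩ := hvs j y (mem_inter.mp this).2
      exact ⟨x, by rw [hy, hx]⟩
    choose p hp using h3
    refine ⟨p, ?_⟩
    ext y
    rw [hψ]
    constructor
    · rintro ⟨j, rfl⟩
      have : v j (p j) ∈ e ∩ W j := by rw [hp]; simp
      exact (mem_inter.mp this).1
    · intro hy
      obtain ⟨j, -, hj⟩ := mem_biUnion.mp (h1 hy)
      have : y ∈ e ∩ W j := mem_inter.mpr ⟨hy, hj⟩
      rw [hp, mem_singleton] at this
      exact ⟨j, this.symm⟩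
  obtain ⟨A, hA6, hAg, hAc, hAab⟩ := hn0 n hn (fun e => ψ e ∈ E) (by
    intro i hi u w
    refine (hdeg i hi (v 0 u) (hvW 0 u) (v i w) (hvW i w)).trans ?_
    have hsub : E.filter (fun e => v 0 u ∈ e ∧ v i w ∈ e) ⊆
      (univ.filter (fun e : Fin 4 → Fin n => e 0 = u ∧ e i = w ∧ ψ e ∈ E)).image ψ := by
      intro e he
      obtain ⟨he, h1, h2⟩ := mem_filter.mp he
      obtain ⟨p, rfl⟩ := hEψ e he
      exact mem_image.mpr ⟨p, by simp [(hψv _ _ _).mp h1, (hψv _ _ _).mp h2, he], rfl⟩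
    have h9 := (card_le_card hsub).trans card_image_le
    refine (Nat.cast_le.mpr h9).trans (le_of_eq ?_)
    congr!)
  let M : Finset (Finset α) := (A ×ˢ (univ : Finset (Fin 4))).image (fun q => ψ (q.1 q.2))
  have hM : ∀ e, e ∈ M ↔ ∃ a ∈ A, ∃ i, ψ (a i) = e := by
    intro e
    simp only [M, mem_image, mem_product, mem_univ, and_true, Prod.exists]
    constructor
    · rintro ⟨a, i, ha, h⟩; exact ⟨a, ha, i, h⟩
    · rintro ⟨a, ha, i, h⟩; exact ⟨a, i, ha, h⟩
  have hMv : ∀ j x, v j x ∈ M.biUnion id ↔ ∃ a ∈ A, ∃ i, a i j = x := by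
    intro j x
    simp only [mem_biUnion, id]
    constructor
    · rintro ⟨e, he, hx⟩
      obtain ⟨a, ha, i, rfl⟩ := (hM e).mp he
      exact ⟨a, ha, i, (hψv _ _ _).mp hx⟩
    · rintro ⟨a, ha, i, h⟩
      exact ⟨_, (hM _).mpr ⟨a, ha, i, rfl⟩, (hψv _ _ _).mpr h⟩
  refine ⟨M, ?_, ?_, ?_, ?_⟩
  · intro e he
    obtain ⟨a, ha, i, rfl⟩ := (hM e).mp he
    exact (hAg a ha).1 i
  · intro e he f hf hef
    obtain ⟨a, ha, i, rfl⟩ := (hM e).mp he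
    obtain ⟨b, hb, i', rfl⟩ := (hM f).mp hf
    apply hψd
    intro j hj
    by_cases hab : a = b
    · subst hab
      by_cases hii : i = i'
      · subst hii; exact hef rfl
      · exact (hAg a ha).2 i i' j hii hj
    · exact hAc a ha b hb hab ⟨i, i', j, hj⟩
  · have h1 : M.card ≤ A.card * 4 := card_image_le.trans (by simp)
    have h2 : (M.card : ℝ) ≤ A.card * 4 := by exact_mod_cast h1
    linarith
  intro S hSW hSM hbal hSn
  set s := (S ∩ W 0).card with hs
  let τ : ∀ j, Fin s ≃ (S ∩ W j : Finset α) := fun j =>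
    ((S ∩ W j).equivFinOfCardEq (hbal j)).symm
  have hτ : ∀ l j, ∃ x, v j x = (τ j l).1 := fun l j => hvs j _ (mem_inter.mp (τ j l).2).2
  choose T hTτ using hτ
  have hTS : ∀ l j, v j (T l j) ∈ S := by
    intro l j; rw [hTτ]; exact (mem_inter.mp (τ j l).2).1
  have hSv : ∀ j x, v j x ∈ S ↔ ∃ l, T l j = x := by
    intro j x
    constructor
    · intro h
      have h' : v j x ∈ S ∩ W j := mem_inter.mpr ⟨h, hvW j x⟩
      refine ⟨(τ j).symm ⟨_, h'⟩, ?_⟩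
      have := hTτ ((τ j).symm ⟨_, h'⟩) j
      rw [Equiv.apply_symm_apply] at this
      exact (hvi _ _ _ _ this).2
    · rintro ⟨l, rfl⟩; exact hTS l j
  obtain ⟨F, hFP, hFi, hFr⟩ := absorb_lemma (fun e => ψ e ∈ E) A hAg hAc s T (by
      intro j l l' h
      have h' : T l j = T l' j := h
      apply (τ j).injective
      apply Subtype.ext
      rw [← hTτ, ← hTτ, h']) (by
      intro l j a ha i h
      exact disjoint_left.mp hSM (hTS l j) ((hMv _ _).mpr ⟨a, ha, i, h.symm⟩)) (by
      intro t
      have h1 : (s : ℝ) ≤ S.card := by exact_mod_cast card_le_card inter_subset_left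
      exact_mod_cast h1.trans (hSn.trans (hAab t)))
  have hU : ∀ j x, v j x ∈ S ∪ M.biUnion id ↔ ∃ q, F q j = x := by
    intro j x
    have h1 : (∃ q, F q j = x) ↔ x ∈ Set.range (base A T j) := by rw [← hFr]; rfl
    rw [h1, mem_union, hSv, hMv]
    constructor
    · rintro (⟨l, h⟩ | ⟨a, ha, i, h⟩)
      · exact ⟨Sum.inr l, h⟩
      · exact ⟨Sum.inl (⟨a, ha⟩, i), h⟩
    · rintro ⟨⟨a, i⟩ | l, h⟩
      · exact Or.inr ⟨a, a.2, i, h⟩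
      · exact Or.inl ⟨l, h⟩
  refine ⟨univ.image (fun q => ψ (F q)), ?_, ?_, ?_⟩
  · intro e he
    obtain ⟨q, -, rfl⟩ := mem_image.mp he
    refine mem_filter.mpr ⟨hFP q, ?_⟩
    intro y hy
    obtain ⟨j, rfl⟩ := (hψ _ _).mp hy
    exact (hU _ _).mpr ⟨q, rfl⟩
  · intro e he f hf hef
    obtain ⟨q, -, rfl⟩ := mem_image.mp he
    obtain ⟨q', -, rfl⟩ := mem_image.mp hf
    apply hψd
    intro j hj
    have := hFi j hj
    subst this
    exact hef rfl
  · intro y hy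
    have hyW : ∃ j, y ∈ W j := by
      rcases mem_union.mp hy with h | h
      · obtain ⟨j, -, hj⟩ := mem_biUnion.mp (hSW h)
        exact ⟨j, hj⟩
      · obtain ⟨e, he, hye⟩ := mem_biUnion.mp h
        obtain ⟨a, ha, i, rfl⟩ := (hM e).mp he
        obtain ⟨j, rfl⟩ := (hψ _ _).mp hye
        exact ⟨j, hvW _ _⟩
    obtain ⟨j, hj⟩ := hyW
    obtain ⟨x, rfl⟩ := hvs j y hj
    obtain ⟨q, hq⟩ := (hU j x).mp hy
    exact ⟨_, mem_image.mpr ⟨q, mem_univ _, rfl⟩, (hψv _ _ _).mpr hq⟩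

/-- For every sufficiently small `γ > 0` there is `β0 > 0` such that for every
`β ∈ (0, β0)` there is `n0` such that for all `n ≥ n0`: if `H` is a balanced
4-partite 4-graph with classes of size `n` and `d_H({x,y}) ≥ (1/2 + γ)n²` for
all `x ∈ V1`, `y ∈ V2 ∪ V3 ∪ V4`, then `H` has a matching `M` of size at most
`γ⁶ n` such that for every balanced set `S` of at most `β n` uncovered
vertices, `H[S ∪ V(M)]` has a perfect matching. -/
theorem absorbing_lemma :
    ∃ γ0 : ℝ, 0 < γ0 ∧ ∀ γ : ℝ, 0 < γ → γ < γ0 →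
    ∃ β0 : ℝ, 0 < β0 ∧ ∀ β : ℝ, 0 < β → β < β0 →
    ∃ n0 : ℕ, ∀ n : ℕ, n0 ≤ n →
    ∀ (α : Type) [DecidableEq α], ∀ V1 V2 V3 V4 : Finset α,
      Disjoint V1 V2 → Disjoint V1 V3 → Disjoint V1 V4 →
      Disjoint V2 V3 → Disjoint V2 V4 → Disjoint V3 V4 →
      V1.card = n → V2.card = n → V3.card = n → V4.card = n →
      ∀ E : Finset (Finset α),
        IsPartite4 V1 V2 V3 V4 E →
        (∀ x ∈ V1, ∀ y ∈ V2 ∪ V3 ∪ V4,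
          ((1 : ℝ) / 2 + γ) * n ^ 2 ≤ (hdeg2 E x y : ℝ)) →
        ∃ M : Finset (Finset α),
          M ⊆ E ∧
          (∀ e ∈ M, ∀ f ∈ M, e ≠ f → Disjoint e f) ∧
          (M.card : ℝ) ≤ γ ^ 6 * n ∧
          ∀ S : Finset α,
            S ⊆ (V1 ∪ V2 ∪ V3 ∪ V4) \ M.biUnion id →
            (S ∩ V1).card = (S ∩ V2).card →
            (S ∩ V2).card = (S ∩ V3).card →
            (S ∩ V3).card = (S ∩ V4).card →
            (S.card : ℝ) ≤ β * n →
            ∃ M' : Finset (Finset α),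
              M' ⊆ E.filter (fun e => e ⊆ S ∪ M.biUnion id) ∧
              (∀ e ∈ M', ∀ f ∈ M', e ≠ f → Disjoint e f) ∧
              (∀ v ∈ S ∪ M.biUnion id, ∃ e ∈ M', v ∈ e) := by
  refine ⟨1/2, by norm_num, fun γ hγ hγ1 => ⟨γ ^ 10 / 100, by positivity, fun β hβ0 hβ => ?_⟩⟩
  obtain ⟨n0, hn0⟩ := transfer_lemma γ hγ hγ1 β hβ0 hβ
  refine ⟨n0, ?_⟩
  intro n hn α _ V1 V2 V3 V4 h12 h13 h14 h23 h24 h34 c1 c2 c3 c4 E hE hdeg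
  have hUn : univ.biUnion ![V1, V2, V3, V4] = V1 ∪ V2 ∪ V3 ∪ V4 := by
    ext y
    simp [Fin.exists_fin_succ, or_assoc]
  obtain ⟨M, hME, hMd, hMc, hMS⟩ := hn0 n hn α ![V1, V2, V3, V4]
    (by
      intro i j hij
      fin_cases i <;> fin_cases j <;> first | exact absurd rfl hij | skip
      all_goals simp [h12, h13, h14, h23, h24, h34, h12.symm, h13.symm, h14.symm, h23.symm,
        h24.symm, h34.symm])
    (by intro i; fin_cases i <;> simp [c1, c2, c3, c4])
    E
    (by
      intro e he
      obtain ⟨h0, h1, h2, h3, h4⟩ := hE e he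
      refine ⟨?_, ?_⟩
      · intro y hy
        have := h0 hy
        rw [← hUn] at this
        exact this
      · intro j
        fin_cases j
        · exact h1
        · exact h2
        · exact h3
        · exact h4)
    (by
      intro j hj x hx y hy
      have hx' : x ∈ V1 := hx
      have hy' : y ∈ V2 ∪ V3 ∪ V4 := by
        fin_cases j
        · exact absurd rfl hj
        · have : y ∈ V2 := hy
          simp [this]
        · have : y ∈ V3 := hy
          simp [this]
        · have : y ∈ V4 := hy
          simp [this]
      have := hdeg x hx' y hy'
      unfold hdeg2 at this
      exact this)
  refine ⟨M, hME, hMd, hMc, ?_⟩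
  intro S hS b1 b2 b3 hSc
  have hS1 : S ⊆ V1 ∪ V2 ∪ V3 ∪ V4 := fun y hy => (mem_sdiff.mp (hS hy)).1
  have hS2 : ∀ y ∈ S, y ∉ M.biUnion id := fun y hy => (mem_sdiff.mp (hS hy)).2
  obtain ⟨M', h1, h2, h3⟩ := hMS S
    (by
      intro y hy
      have := hS1 hy
      rw [← hUn] at this
      exact this)
    (by
      rw [disjoint_left]
      intro y hy hy'
      apply hS2 y hy
      exact hy')
    (by
      intro j
      fin_cases j
      · rfl
      · exact b1.symm
      · exact (b1.trans b2).symm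
      · exact (b1.trans (b2.trans b3)).symm)
    hSc
  refine ⟨M', ?_, h2, ?_⟩
  · exact h1
  · intro y hy
    apply h3
    exact hy
end

section
/- For every sufficiently small ε > 0 there exists γ0 > 0 such that for every γ ∈ (0, γ0) there exists n0 ∈ ℕ such that the following holds for all n ≥ n0. Let H be a balanced 4-partite 4-graph with vertex classes V1, V2, V3, V4, each of size n, such that H is not ε-close to H'_{1,3}(n) and d_H({x,y}) ≥ (5/9 − γ)n² for every x ∈ V1 and every y ∈ V2 ∪ V3 ∪ V4. Then H has a fractional perfect matching f whose support {e ∈ E(H) : f(e) > 0} has size at most 4n. -/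
open Finset

/-- The edge set of `H'₁,₃(n)` for the choice `W2, W3, W4` of the partition
sets: all quadruples with one vertex in each class that meet `W2 ∪ W3 ∪ W4`
and meet `(V2 \ W2) ∪ (V3 \ W3) ∪ (V4 \ W4)`. -/
def H13edges {α : Type} [DecidableEq α] (V1 V2 V3 V4 W2 W3 W4 : Finset α) :
    Finset (Finset α) :=
  (V1 ∪ V2 ∪ V3 ∪ V4).powerset.filter (fun e =>
    (e ∩ V1).card = 1 ∧ (e ∩ V2).card = 1 ∧ (e ∩ V3).card = 1 ∧
    (e ∩ V4).card = 1 ∧ (e ∩ (W2 ∪ W3 ∪ W4)).Nonempty ∧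
    (e ∩ ((V2 \ W2) ∪ (V3 \ W3) ∪ (V4 \ W4))).Nonempty)

/-- `W2, W3, W4` is a valid choice of partition sets for `H'₁,₃(n)`:
`Wi ⊆ Vi`, `|Wi| ∈ {⌊n/3⌋, ⌈n/3⌉}` and `|W2| + |W3| + |W4| = n`. -/
def IsWChoice {α : Type} [DecidableEq α] (n : ℕ) (V2 V3 V4 W2 W3 W4 : Finset α) :
    Prop :=
  W2 ⊆ V2 ∧ W3 ⊆ V3 ∧ W4 ⊆ V4 ∧
  (W2.card = n / 3 ∨ W2.card = (n + 2) / 3) ∧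
  (W3.card = n / 3 ∨ W3.card = (n + 2) / 3) ∧
  (W4.card = n / 3 ∨ W4.card = (n + 2) / 3) ∧
  W2.card + W3.card + W4.card = n

/-- `H` (with edge set `E`) is `ε`-close to `H'₁,₃(n)`: for some valid choice of
the partition sets `W2, W3, W4`, at most `ε n⁴` edges of `H'₁,₃(n)` are missing
from `E`. -/
def CloseToH13 {α : Type} [DecidableEq α] (ε : ℝ) (n : ℕ)
    (V1 V2 V3 V4 : Finset α) (E : Finset (Finset α)) : Prop :=
  ∃ W2 W3 W4 : Finset α, IsWChoice n V2 V3 V4 W2 W3 W4 ∧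
    (((H13edges V1 V2 V3 V4 W2 W3 W4) \ E).card : ℝ) ≤ ε * n ^ 4


/-- `f` is a fractional perfect matching of the hypergraph with vertex set `V`
and edge set `E`: `f` vanishes off `E`, takes values in `[0,1]`, and the total
weight of the edges at every vertex is exactly `1`. -/
def IsFracPM {α : Type} [DecidableEq α] (V : Finset α) (E : Finset (Finset α))
    (f : Finset α → ℝ) : Prop :=
  (∀ e, e ∉ E → f e = 0) ∧ (∀ e ∈ E, 0 ≤ f e ∧ f e ≤ 1) ∧
  (∀ v ∈ V, ∑ e ∈ E.filter (fun e => v ∈ e), f e = 1)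



lemma pt_Q_aux (γ l1 l2 l3 m1 m2 m3 : ℝ) (hγ0 : 0 ≤ γ) (hγ : γ ≤ 1/100)
    (hm1 : 0 ≤ m1) (hm2 : 0 ≤ m2)
    (h1 : l1 + m1 ≤ 1) (h2 : l2 + m2 ≤ 1)
    (h12 : 2*l2+m2 ≤ 2*l1+m1) (h23 : 2*l3+m3 ≤ 2*l2+m2)
    (hf : l1*l2+l1*m2+m1*l2 ≤ 4/9+γ) :
    (2*l1+m1)+(2*l2+m2)+(2*l3+m3) ≤ 4+5*γ := by
  by_contra! hc
  obtain ⟨s1, hs1⟩ : ∃ s, s = 2*l1+m1 := ⟨_, rfl⟩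
  obtain ⟨s2, hs2⟩ : ∃ s, s = 2*l2+m2 := ⟨_, rfl⟩
  have e1 : l1 = (s1-m1)/2 := by linarith
  have e2 : l2 = (s2-m2)/2 := by linarith
  subst e1 e2
  have hs12 : s1 ≤ 2 := by linarith
  have hm1' : m1 ≤ 2 - s1 := by linarith
  have hm2' : m2 ≤ 2 - s2 := by linarith
  have hs1l : (4+5*γ)/3 ≤ s1 := by linarith
  have hs2l : (4+5*γ-s1)/2 ≤ s2 := by linarith
  have k1 : 0 ≤ (3*s1-4)*m2 := mul_nonneg (by linarith) hm2
  have k2 : 0 ≤ (2*s2-2)*m1 := mul_nonneg (by linarith) hm1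
  have k3 : m1*m2 ≤ (2-s1)*m2 := mul_le_mul_of_nonneg_right hm1' hm2
  have k4 : m1*m2 ≤ m1*(2-s2) := mul_le_mul_of_nonneg_left hm2' hm1
  have k5 : s1*((4+5*γ-s1)/2) ≤ s1*s2 := mul_le_mul_of_nonneg_left hs2l (by linarith)
  have k6 : 0 ≤ (s1-(4+5*γ)/3)*(2-s1) := mul_nonneg (by linarith) (by linarith)
  have k7 : s1 * s2 ≤ 16/9+4*γ := by nlinarith
  rcases eq_or_lt_of_le hγ0 with h0 | h0
  · subst h0
    nlinarith
  · nlinarith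

lemma pt_Q (γ l1 l2 l3 m1 m2 m3 : ℝ) (hγ0 : 0 ≤ γ) (hγ : γ ≤ 1/100)
    (hm1 : 0 ≤ m1) (hm2 : 0 ≤ m2) (hm3 : 0 ≤ m3)
    (h1 : l1 + m1 ≤ 1) (h2 : l2 + m2 ≤ 1) (h3 : l3 + m3 ≤ 1)
    (hf12 : l1*l2+l1*m2+m1*l2 ≤ 4/9+γ)
    (hf13 : l1*l3+l1*m3+m1*l3 ≤ 4/9+γ)
    (hf23 : l2*l3+l2*m3+m2*l3 ≤ 4/9+γ) :
    (2*l1+m1)+(2*l2+m2)+(2*l3+m3) ≤ 4+5*γ := by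
  have hf21 : l2*l1+l2*m1+m2*l1 ≤ 4/9+γ := by linarith
  have hf31 : l3*l1+l3*m1+m3*l1 ≤ 4/9+γ := by linarith
  have hf32 : l3*l2+l3*m2+m3*l2 ≤ 4/9+γ := by linarith
  rcases le_total (2*l1+m1) (2*l2+m2) with a | a <;>
  rcases le_total (2*l1+m1) (2*l3+m3) with b | b <;>
  rcases le_total (2*l2+m2) (2*l3+m3) with c | c
  · linarith [pt_Q_aux γ l3 l2 l1 m3 m2 m1 hγ0 hγ hm3 hm2 h3 h2 c a hf32]
  · linarith [pt_Q_aux γ l2 l3 l1 m2 m3 m1 hγ0 hγ hm2 hm3 h2 h3 c b hf23]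
  · linarith [pt_Q_aux γ l3 l2 l1 m3 m2 m1 hγ0 hγ hm3 hm2 h3 h2 c a hf32]
  · linarith [pt_Q_aux γ l2 l1 l3 m2 m1 m3 hγ0 hγ hm2 hm1 h2 h1 a b hf21]
  · linarith [pt_Q_aux γ l3 l1 l2 m3 m1 m2 hγ0 hγ hm3 hm1 h3 h1 b a hf31]
  · linarith [pt_Q_aux γ l1 l2 l3 m1 m2 m3 hγ0 hγ hm1 hm2 h1 h2 a c hf12]
  · linarith [pt_Q_aux γ l1 l3 l2 m1 m3 m2 hγ0 hγ hm1 hm3 h1 h3 b c hf13]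
  · linarith [pt_Q_aux γ l1 l2 l3 m1 m2 m3 hγ0 hγ hm1 hm2 h1 h2 a c hf12]

lemma pt_S_aux (θ l1 l2 l3 m1 m2 m3 : ℝ) (hθ0 : 0 ≤ θ) (hθ : θ ≤ 1/10000)
    (hl1 : 0 ≤ l1) (hm1 : 0 ≤ m1) (hm2 : 0 ≤ m2)
    (h1 : l1 + m1 ≤ 1) (h2 : l2 + m2 ≤ 1)
    (h12 : 2*l2+m2 ≤ 2*l1+m1) (h23 : 2*l3+m3 ≤ 2*l2+m2)
    (hf : l1*l2+l1*m2+m1*l2 ≤ 4/9+θ)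
    (hS : 4 - θ ≤ (2*l1+m1)+(2*l2+m2)+(2*l3+m3)) :
    2*l1+m1 ≤ 4/3+21*θ := by
  by_contra! hc
  obtain ⟨s1, hs1⟩ : ∃ s, s = 2*l1+m1 := ⟨_, rfl⟩
  obtain ⟨s2, hs2⟩ : ∃ s, s = 2*l2+m2 := ⟨_, rfl⟩
  have e1 : l1 = (s1-m1)/2 := by linarith
  have e2 : l2 = (s2-m2)/2 := by linarith
  subst e1 e2
  have hs12 : s1 ≤ 2 := by linarith
  have hm1' : m1 ≤ 2 - s1 := by linarith
  have hm2' : m2 ≤ 2 - s2 := by linarith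
  have hs1l : 4/3+21*θ < s1 := by linarith
  have hs2l : (4-θ-s1)/2 ≤ s2 := by linarith
  have k1 : 0 ≤ (3*s1-4)*m2 := mul_nonneg (by linarith) hm2
  have k2 : 0 ≤ (2*s2-2+θ)*m1 := mul_nonneg (by linarith) hm1
  have k2' : θ * m1 ≤ θ := by nlinarith
  have k3 : m1*m2 ≤ (2-s1)*m2 := mul_le_mul_of_nonneg_right hm1' hm2
  have k4 : m1*m2 ≤ m1*(2-s2) := mul_le_mul_of_nonneg_left hm2' hm1
  have k5 : s1*((4-θ-s1)/2) ≤ s1*s2 := mul_le_mul_of_nonneg_left hs2l (by linarith)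
  have k8 : θ * s1 ≤ θ * 2 := by nlinarith
  have k6 : 0 ≤ (s1-4/3)*(2-s1) := mul_nonneg (by linarith) (by linarith)
  have k7 : s1 * s2 ≤ 16/9+4*θ + θ := by nlinarith
  nlinarith

lemma pt_S_max (θ l1 l2 l3 m1 m2 m3 : ℝ) (hθ0 : 0 ≤ θ) (hθ : θ ≤ 1/10000)
    (hl1 : 0 ≤ l1) (hl2 : 0 ≤ l2) (hl3 : 0 ≤ l3)
    (hm1 : 0 ≤ m1) (hm2 : 0 ≤ m2) (hm3 : 0 ≤ m3)
    (h1 : l1 + m1 ≤ 1) (h2 : l2 + m2 ≤ 1) (h3 : l3 + m3 ≤ 1)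
    (hf12 : l1*l2+l1*m2+m1*l2 ≤ 4/9+θ)
    (hf13 : l1*l3+l1*m3+m1*l3 ≤ 4/9+θ)
    (hf23 : l2*l3+l2*m3+m2*l3 ≤ 4/9+θ)
    (hS : 4 - θ ≤ (2*l1+m1)+(2*l2+m2)+(2*l3+m3)) :
    2*l1+m1 ≤ 4/3+21*θ ∧ 2*l2+m2 ≤ 4/3+21*θ ∧ 2*l3+m3 ≤ 4/3+21*θ := by
  have hf21 : l2*l1+l2*m1+m2*l1 ≤ 4/9+θ := by linarith
  have hf31 : l3*l1+l3*m1+m3*l1 ≤ 4/9+θ := by linarith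
  have hf32 : l3*l2+l3*m2+m3*l2 ≤ 4/9+θ := by linarith
  rcases le_total (2*l1+m1) (2*l2+m2) with a | a <;>
  rcases le_total (2*l1+m1) (2*l3+m3) with b | b <;>
  rcases le_total (2*l2+m2) (2*l3+m3) with c | c
  · have := pt_S_aux θ l3 l2 l1 m3 m2 m1 hθ0 hθ hl3 hm3 hm2 h3 h2 c a hf32 (by linarith)
    refine ⟨?_, ?_, ?_⟩ <;> linarith
  · have := pt_S_aux θ l2 l3 l1 m2 m3 m1 hθ0 hθ hl2 hm2 hm3 h2 h3 c b hf23 (by linarith)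
    refine ⟨?_, ?_, ?_⟩ <;> linarith
  · have := pt_S_aux θ l3 l2 l1 m3 m2 m1 hθ0 hθ hl3 hm3 hm2 h3 h2 c a hf32 (by linarith)
    refine ⟨?_, ?_, ?_⟩ <;> linarith
  · have := pt_S_aux θ l2 l1 l3 m2 m1 m3 hθ0 hθ hl2 hm2 hm1 h2 h1 a b hf21 (by linarith)
    refine ⟨?_, ?_, ?_⟩ <;> linarith
  · have := pt_S_aux θ l3 l1 l2 m3 m1 m2 hθ0 hθ hl3 hm3 hm1 h3 h1 b a hf31 (by linarith)
    refine ⟨?_, ?_, ?_⟩ <;> linarith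
  · have := pt_S_aux θ l1 l2 l3 m1 m2 m3 hθ0 hθ hl1 hm1 hm2 h1 h2 a c hf12 (by linarith)
    refine ⟨?_, ?_, ?_⟩ <;> linarith
  · have := pt_S_aux θ l1 l3 l2 m1 m3 m2 hθ0 hθ hl1 hm1 hm3 h1 h3 b c hf13 (by linarith)
    refine ⟨?_, ?_, ?_⟩ <;> linarith
  · have := pt_S_aux θ l1 l2 l3 m1 m2 m3 hθ0 hθ hl1 hm1 hm2 h1 h2 a c hf12 (by linarith)
    refine ⟨?_, ?_, ?_⟩ <;> linarith

lemma pt_S_mid (θ l1 l2 m1 m2 : ℝ) (hθ0 : 0 ≤ θ) (hθ : θ ≤ 1/10000)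
    (hm1 : 0 ≤ m1) (hm2 : 0 ≤ m2)
    (h1 : l1 + m1 ≤ 1) (h2 : l2 + m2 ≤ 1)
    (hf : l1*l2+l1*m2+m1*l2 ≤ 4/9+θ)
    (hs1 : 4/3-43*θ ≤ 2*l1+m1) (hs2 : 4/3-43*θ ≤ 2*l2+m2) :
    m1 + m2 ≤ 400*θ := by
  obtain ⟨s1, hs1'⟩ : ∃ s, s = 2*l1+m1 := ⟨_, rfl⟩
  obtain ⟨s2, hs2'⟩ : ∃ s, s = 2*l2+m2 := ⟨_, rfl⟩
  have e1 : l1 = (s1-m1)/2 := by linarith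
  have e2 : l2 = (s2-m2)/2 := by linarith
  subst e1 e2
  have hm1' : m1 ≤ 2/3+43*θ := by linarith
  have hm2' : m2 ≤ 2/3+43*θ := by linarith
  have k3 : m1*m2 ≤ (2/3+43*θ)*m2 := mul_le_mul_of_nonneg_right hm1' hm2
  have k4 : m1*m2 ≤ m1*(2/3+43*θ) := mul_le_mul_of_nonneg_left hm2' hm1
  have a1 : 4/3-43*θ ≤ s1 := by linarith
  have a2 : 4/3-43*θ ≤ s2 := by linarith
  have k5 : (4/3-43*θ)*m2 ≤ s1*m2 := mul_le_mul_of_nonneg_right a1 hm2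
  have k6 : (4/3-43*θ)*m1 ≤ s2*m1 := mul_le_mul_of_nonneg_right a2 hm1
  have k7 : (4/3-43*θ)*(4/3-43*θ) ≤ s1*s2 := mul_le_mul a1 a2 (by linarith) (by linarith)
  have k8 : θ*(m1+m2) ≤ 1/10000*(m1+m2) := mul_le_mul_of_nonneg_right hθ (by linarith)
  nlinarith

lemma pt_S (θ l1 l2 l3 m1 m2 m3 : ℝ) (hθ0 : 0 ≤ θ) (hθ : θ ≤ 1/10000)
    (hl1 : 0 ≤ l1) (hl2 : 0 ≤ l2) (hl3 : 0 ≤ l3)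
    (hm1 : 0 ≤ m1) (hm2 : 0 ≤ m2) (hm3 : 0 ≤ m3)
    (h1 : l1 + m1 ≤ 1) (h2 : l2 + m2 ≤ 1) (h3 : l3 + m3 ≤ 1)
    (hf12 : l1*l2+l1*m2+m1*l2 ≤ 4/9+θ)
    (hf13 : l1*l3+l1*m3+m1*l3 ≤ 4/9+θ)
    (hf23 : l2*l3+l2*m3+m2*l3 ≤ 4/9+θ)
    (hS : 4 - θ ≤ (2*l1+m1)+(2*l2+m2)+(2*l3+m3)) :
    (2/3-250*θ ≤ l1 ∧ l1 ≤ 2/3+250*θ) ∧ (2/3-250*θ ≤ l2 ∧ l2 ≤ 2/3+250*θ) ∧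
    (2/3-250*θ ≤ l3 ∧ l3 ≤ 2/3+250*θ) := by
  obtain ⟨a1, a2, a3⟩ := pt_S_max θ l1 l2 l3 m1 m2 m3 hθ0 hθ hl1 hl2 hl3 hm1 hm2 hm3
    h1 h2 h3 hf12 hf13 hf23 hS
  have b1 := pt_S_mid θ l1 l2 m1 m2 hθ0 hθ hm1 hm2 h1 h2 hf12 (by linarith) (by linarith)
  have b2 := pt_S_mid θ l1 l3 m1 m3 hθ0 hθ hm1 hm3 h1 h3 hf13 (by linarith) (by linarith)
  refine ⟨⟨?_, ?_⟩, ⟨?_, ?_⟩, ⟨?_, ?_⟩⟩ <;> linarith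

lemma grid_count (K : ℕ) (a : ℝ) (ha : 0 ≤ a) :
    (1/(2*K+1:ℝ)) * (((Icc 1 K).filter (fun k : ℕ => (k:ℝ)*(1/(2*K+1:ℝ)) ≤ a)).card +
      ((Icc 1 K).filter (fun k : ℕ => 1 - (k:ℝ)*(1/(2*K+1:ℝ)) ≤ a)).card : ℝ) ≤ a := by
  have hp : (0:ℝ) < 2*K+1 := by positivity
  set N := ⌊a*(2*K+1)⌋₊ with hN
  have hNle : (N:ℝ) ≤ a*(2*K+1) := Nat.floor_le (by positivity)
  have s1 : (Icc 1 K).filter (fun k : ℕ => (k:ℝ)*(1/(2*K+1:ℝ)) ≤ a) ⊆ Icc 1 (min N K) := by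
    intro k hk
    simp only [mem_filter, mem_Icc] at hk ⊢
    have : (k:ℝ) ≤ a*(2*K+1) := by
      have := hk.2
      rw [mul_one_div, div_le_iff₀ hp] at this
      exact this
    have := Nat.le_floor this
    omega
  have s2 : (Icc 1 K).filter (fun k : ℕ => 1 - (k:ℝ)*(1/(2*K+1:ℝ)) ≤ a) ⊆
      Icc (max 1 (2*K+1-N)) K := by
    intro k hk
    simp only [mem_filter, mem_Icc] at hk ⊢
    have : ((2*K+1-k : ℕ):ℝ) ≤ a*(2*K+1) := by
      rw [Nat.cast_sub (by omega)]
      push_cast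
      have := hk.2
      rw [mul_one_div, sub_le_iff_le_add, ← sub_le_iff_le_add', le_div_iff₀ hp] at this
      linarith
    have := Nat.le_floor this
    omega
  have c1 := card_le_card s1
  have c2 := card_le_card s2
  rw [Nat.card_Icc] at c1 c2
  have c3 : ((Icc 1 K).filter (fun k : ℕ => (k:ℝ)*(1/(2*K+1:ℝ)) ≤ a)).card +
      ((Icc 1 K).filter (fun k : ℕ => 1 - (k:ℝ)*(1/(2*K+1:ℝ)) ≤ a)).card ≤ N := by omega
  have c4 : (((Icc 1 K).filter (fun k : ℕ => (k:ℝ)*(1/(2*K+1:ℝ)) ≤ a)).card +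
      ((Icc 1 K).filter (fun k : ℕ => 1 - (k:ℝ)*(1/(2*K+1:ℝ)) ≤ a)).card : ℝ) ≤ N := by
    exact_mod_cast c3
  refine (mul_le_mul_of_nonneg_left c4 (by positivity)).trans ?_
  rw [one_div, inv_mul_le_iff₀ hp]
  linarith


noncomputable def lowS {α : Type} (P : Finset α) (u : α → ℝ) (t : ℝ) : Finset α := P.filter (fun y => u y < t)
noncomputable def midS {α : Type} (P : Finset α) (u : α → ℝ) (t : ℝ) : Finset α :=
  P.filter (fun y => t ≤ u y ∧ u y < 1 - t)

lemma low_mid_le {α : Type} (P : Finset α) (u : α → ℝ) (t : ℝ) :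
    (lowS P u t).card + (midS P u t).card ≤ P.card := by
  classical
  rw [← card_union_of_disjoint]
  · apply card_le_card
    intro y hy
    simp only [lowS, midS, mem_union, mem_filter] at hy
    tauto
  · rw [disjoint_left]
    intro y h1 h2
    simp only [lowS, midS, mem_filter] at h1 h2
    linarith [h1.2, h2.2.1]

lemma card_low_compl {α : Type} (P : Finset α) (u : α → ℝ) (t : ℝ) :
    ((P.filter (fun y => t ≤ u y)).card : ℝ) = P.card - (lowS P u t).card := by
  have := card_filter_add_card_filter_not (s := P) (fun y => u y < t)
  simp only [not_lt] at this
  rw [lowS, ← this]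
  push_cast
  ring

lemma card_high {α : Type} (P : Finset α) (u : α → ℝ) (t : ℝ) (ht : t < 1 - t) :
    ((P.filter (fun y => 1 - t ≤ u y)).card : ℝ) =
      P.card - (lowS P u t).card - (midS P u t).card := by
  rw [← card_low_compl, midS, ← filter_filter]
  have := card_filter_add_card_filter_not (s := P.filter (fun y => t ≤ u y)) (fun y => u y < 1 - t)
  rw [← this]
  push_cast
  rw [add_sub_cancel_left, filter_filter]
  congr 2
  ext y
  simp only [mem_filter, not_lt]
  constructor
  · rintro ⟨a, b⟩
    exact ⟨a, by linarith, b⟩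
  · rintro ⟨a, _, b⟩
    exact ⟨a, b⟩

lemma level_sum {α : Type} (P : Finset α) (u : α → ℝ) (hu : ∀ y ∈ P, 0 ≤ u y) (K : ℕ) :
    (1/(2*K+1:ℝ)) * ∑ k ∈ Icc 1 K, (2*(P.card:ℝ) - 2*(lowS P u (k*(1/(2*K+1:ℝ)))).card
      - (midS P u (k*(1/(2*K+1:ℝ)))).card) ≤ ∑ y ∈ P, u y := by
  have hp : (0:ℝ) < 2*K+1 := by positivity
  have h1 : ∀ y ∈ P, (1/(2*K+1:ℝ)) *
      (((Icc 1 K).filter (fun k : ℕ => (k:ℝ)*(1/(2*K+1:ℝ)) ≤ u y)).card +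
      ((Icc 1 K).filter (fun k : ℕ => 1 - (k:ℝ)*(1/(2*K+1:ℝ)) ≤ u y)).card : ℝ) ≤ u y :=
    fun y hy => grid_count K (u y) (hu y hy)
  refine le_trans (le_of_eq ?_) (sum_le_sum h1)
  rw [← mul_sum]
  congr 1
  have h2 : ∀ k ∈ Icc 1 K, (2*(P.card:ℝ) - 2*(lowS P u (k*(1/(2*K+1:ℝ)))).card
      - (midS P u (k*(1/(2*K+1:ℝ)))).card) =
      ((P.filter (fun y => (k:ℝ)*(1/(2*K+1:ℝ)) ≤ u y)).card : ℝ) +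
      ((P.filter (fun y => 1 - (k:ℝ)*(1/(2*K+1:ℝ)) ≤ u y)).card : ℝ) := by
    intro k hk
    rw [card_low_compl, card_high]
    · ring
    · rw [mem_Icc] at hk
      have : (k:ℝ) ≤ K := by exact_mod_cast hk.2
      rw [mul_one_div, lt_sub_iff_add_lt, ← add_div, div_lt_one hp]
      linarith
  rw [sum_congr rfl h2, sum_add_distrib, sum_add_distrib]
  simp only [card_filter]
  push_cast
  congr 1 <;> exact sum_comm

lemma pair_count {α : Type} (P Q : Finset α) (u : α → ℝ) (t : ℝ) (ht : t < 1 - t) :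
    (lowS P u t).card * (lowS Q u t).card + (lowS P u t).card * (midS Q u t).card
      + (midS P u t).card * (lowS Q u t).card
      ≤ ((P ×ˢ Q).filter (fun p => u p.1 + u p.2 < 1)).card := by
  classical
  rw [← card_product, ← card_product, ← card_product, ← card_union_of_disjoint,
    ← card_union_of_disjoint]
  · apply card_le_card
    rintro ⟨a, b⟩ h
    simp only [lowS, midS, mem_union, mem_product, mem_filter] at h ⊢
    rcases h with (h | h) | h
    · exact ⟨⟨h.1.1, h.2.1⟩, by linarith [h.1.2, h.2.2]⟩
    · exact ⟨⟨h.1.1, h.2.1⟩, by linarith [h.1.2, h.2.2.2]⟩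
    · exact ⟨⟨h.1.1, h.2.1⟩, by linarith [h.1.2.2, h.2.2]⟩
  · rw [disjoint_left]
    rintro ⟨a, b⟩ h1 h2
    simp only [lowS, midS, mem_union, mem_product, mem_filter] at h1 h2
    rcases h1 with h | h <;> linarith [h2.1.2.1, h.1.2]
  · rw [disjoint_left]
    rintro ⟨a, b⟩ h1 h2
    simp only [lowS, midS, mem_union, mem_product, mem_filter] at h1 h2
    linarith [h2.2.2.1, h1.2.2]

set_option maxHeartbeats 1000000 in
lemma analytic {α : Type} (P2 P3 P4 : Finset α) (u : α → ℝ) (n L : ℕ) (γ : ℝ)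
    (hn : 0 < n) (hL : 20000 ≤ L) (hγ0 : 0 ≤ γ) (hγ : γ ≤ 1/(5*(L:ℝ)^2))
    (c2 : P2.card = n) (c3 : P3.card = n) (c4 : P4.card = n)
    (u2 : ∀ y ∈ P2, 0 ≤ u y) (u3 : ∀ y ∈ P3, 0 ≤ u y) (u4 : ∀ y ∈ P4, 0 ≤ u y)
    (h23 : (((P2 ×ˢ P3).filter (fun p => u p.1 + u p.2 < 1)).card : ℝ) ≤ (4/9+γ)*n^2)
    (h24 : (((P2 ×ˢ P4).filter (fun p => u p.1 + u p.2 < 1)).card : ℝ) ≤ (4/9+γ)*n^2)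
    (h34 : (((P3 ×ˢ P4).filter (fun p => u p.1 + u p.2 < 1)).card : ℝ) ≤ (4/9+γ)*n^2)
    (htot : ∑ y ∈ P2, u y + ∑ y ∈ P3, u y + ∑ y ∈ P4, u y ≤ n) :
    (1 - 1/(L:ℝ)^2) * n ≤ ∑ y ∈ P2, u y + ∑ y ∈ P3, u y + ∑ y ∈ P4, u y ∧
    ∃ t : ℝ, 0 < t ∧ t ≤ 1/(2*L) ∧
      (∀ P, P = P2 ∨ P = P3 ∨ P = P4 → (2/3-500/L)*n ≤ ((lowS P u t).card : ℝ) ∧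
        ((lowS P u t).card : ℝ) ≤ (2/3+500/L)*n) := by
  have hnR : (0:ℝ) < n := by exact_mod_cast hn
  have hLR : (20000:ℝ) ≤ L := by exact_mod_cast hL
  have hL0 : (0:ℝ) < L := by linarith
  have hL1 : 1 ≤ L := le_trans (by norm_num) hL
  clear hL
  obtain ⟨K, hK⟩ : ∃ K : ℕ, K = L^2 := ⟨_, rfl⟩
  have hLK : L ≤ K := by rw [hK]; nlinarith
  have hKR : (K:ℝ) = (L:ℝ)^2 := by rw [hK]; push_cast; ring
  have hKL : (20000:ℝ) * L ≤ K := by rw [hKR]; nlinarith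
  have hγK : 5*γ*K ≤ 1 := by
    rw [hKR]
    rw [le_div_iff₀ (by positivity)] at hγ
    linarith
  have hγs : γ ≤ 1/10000 := by nlinarith
  have hp : (0:ℝ) < 2*K+1 := by positivity
  have g2 := level_sum P2 u u2 K
  have g3 := level_sum P3 u u3 K
  have g4 := level_sum P4 u u4 K
  obtain ⟨h, hh⟩ : ∃ h : ℝ, h = 1/(2*K+1:ℝ) := ⟨_, rfl⟩
  rw [← hh] at g2 g3 g4
  have hhp : 0 < h := by rw [hh]; positivity
  have hhK : h * (2*K+1) = 1 := by rw [hh]; field_simp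
  -- normalised densities
  obtain ⟨l, hl⟩ : ∃ l : Finset α → ℕ → ℝ, ∀ P k, l P k = ((lowS P u (k*h)).card : ℝ) / n :=
    ⟨fun P k => ((lowS P u (k*h)).card : ℝ) / n, fun _ _ => rfl⟩
  obtain ⟨m, hm⟩ : ∃ m : Finset α → ℕ → ℝ, ∀ P k, m P k = ((midS P u (k*h)).card : ℝ) / n :=
    ⟨fun P k => ((midS P u (k*h)).card : ℝ) / n, fun _ _ => rfl⟩
  have hlow : ∀ (P : Finset α) (k : ℕ), ((lowS P u (k*h)).card : ℝ) = l P k * n := by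
    intro P k; rw [hl]; exact (div_mul_cancel₀ _ hnR.ne').symm
  have hmid : ∀ (P : Finset α) (k : ℕ), ((midS P u (k*h)).card : ℝ) = m P k * n := by
    intro P k; rw [hm]; exact (div_mul_cancel₀ _ hnR.ne').symm
  have l0 : ∀ P k, 0 ≤ l P k := fun P k => by rw [hl]; exact div_nonneg (Nat.cast_nonneg _) hnR.le
  have m0 : ∀ P k, 0 ≤ m P k := fun P k => by rw [hm]; exact div_nonneg (Nat.cast_nonneg _) hnR.le
  have lm1 : ∀ P k, P.card = n → l P k + m P k ≤ 1 := by
    intro P k hP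
    have := low_mid_le P u (k*h)
    rw [hP] at this
    have : ((lowS P u (k*h)).card : ℝ) + (midS P u (k*h)).card ≤ n := by exact_mod_cast this
    rw [hlow, hmid, ← add_mul] at this
    by_contra! hc
    nlinarith
  have hlt : ∀ k ∈ Icc 1 K, (k:ℝ)*h < 1 - k*h := by
    intro k hk
    rw [mem_Icc] at hk
    have : (k:ℝ) ≤ K := by exact_mod_cast hk.2
    nlinarith
  have hpair : ∀ P Q, (((P ×ˢ Q).filter (fun p => u p.1 + u p.2 < 1)).card : ℝ) ≤ (4/9+γ)*n^2 →
      ∀ k ∈ Icc 1 K, l P k * l Q k + l P k * m Q k + m P k * l Q k ≤ 4/9+γ := by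
    intro P Q hPQ k hk
    have := pair_count P Q u (k*h) (hlt k hk)
    have h' : ((lowS P u (k*h)).card * (lowS Q u (k*h)).card
      + (lowS P u (k*h)).card * (midS Q u (k*h)).card
      + (midS P u (k*h)).card * (lowS Q u (k*h)).card : ℝ) ≤ (4/9+γ)*n^2 :=
      le_trans (by exact_mod_cast this) hPQ
    simp only [hlow, hmid] at h'
    have hn2 : (0:ℝ) < (n:ℝ)^2 := by positivity
    by_contra! hc
    nlinarith
  obtain ⟨s, hs⟩ : ∃ s : ℕ → ℝ, ∀ k, s k =
      (2*l P2 k + m P2 k) + (2*l P3 k + m P3 k) + (2*l P4 k + m P4 k) := ⟨_, fun _ => rfl⟩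
  have hQ : ∀ k ∈ Icc 1 K, s k ≤ 4+5*γ := by
    intro k hk
    rw [hs]
    exact pt_Q γ _ _ _ _ _ _ hγ0 (by linarith) (m0 _ _) (m0 _ _) (m0 _ _) (lm1 _ _ c2)
      (lm1 _ _ c3) (lm1 _ _ c4) (hpair _ _ h23 k hk) (hpair _ _ h24 k hk) (hpair _ _ h34 k hk)
  obtain ⟨T, hT⟩ : ∃ T, T = ∑ y ∈ P2, u y + ∑ y ∈ P3, u y + ∑ y ∈ P4, u y := ⟨_, rfl⟩
  rw [← hT] at htot ⊢
  have hsum : h * ∑ k ∈ Icc 1 K, (6 - s k) * n ≤ T := by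
    rw [hT]
    refine le_trans (le_of_eq ?_) (add_le_add (add_le_add g2 g3) g4)
    rw [← mul_add, ← mul_add, ← sum_add_distrib, ← sum_add_distrib]
    congr 1
    apply sum_congr rfl
    intro k _
    rw [c2, c3, c4]
    simp only [hlow, hmid, hs]
    ring
  rw [← sum_mul] at hsum
  have hcard : ((Icc 1 K).card : ℝ) = K := by simp
  have hsum2 : (∑ k ∈ Icc 1 K, (6 - s k)) = K * (2 - 5*γ) + ∑ k ∈ Icc 1 K, (4+5*γ - s k) := by
    have : ∀ k ∈ Icc 1 K, 6 - s k = (2-5*γ) + (4+5*γ - s k) := fun k _ => by ring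
    rw [sum_congr rfl this, sum_add_distrib, sum_const, nsmul_eq_mul, hcard]
  obtain ⟨D, hD⟩ : ∃ D, D = ∑ k ∈ Icc 1 K, (4+5*γ - s k) := ⟨_, rfl⟩
  have hD0 : 0 ≤ D := hD ▸ sum_nonneg (fun k hk => by linarith [hQ k hk])
  rw [hsum2, ← hD] at hsum
  constructor
  · refine le_trans ?_ hsum
    rw [← mul_assoc]
    apply mul_le_mul_of_nonneg_right _ hnR.le
    have e1 : h * (2*K) = 1 - h := by linarith
    have e2 : h ≤ 1/(2*(L:ℝ)^2) := by
      rw [hh, hKR]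
      apply one_div_le_one_div_of_le (by positivity); linarith
    have e3 : 1/(2*(L:ℝ)^2) = (1/2) * (1/(L:ℝ)^2) := by field_simp
    have e4 : 1/(5*(L:ℝ)^2) = (1/5) * (1/(L:ℝ)^2) := by field_simp
    have e5 : h * (5*γ*K) ≤ h * 1 := mul_le_mul_of_nonneg_left hγK hhp.le
    have e6 : 0 ≤ h * D := by positivity
    have e7 : h * K * γ ≤ (1/2) * γ := mul_le_mul_of_nonneg_right (by linarith) hγ0
    have e9 : h * (K*(2-5*γ)+D) = h*(2*K) - 5*(h*K*γ) + h*D := by ring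
    rw [e9]
    linarith
  · have hD2 : D ≤ 2 := by
      have a1 : h * (K*(2-5*γ)+D) ≤ 1 := by
        by_contra! hc
        nlinarith
      have a2 : K*(2-5*γ)+D ≤ 2*K+1 := by
        by_contra! hc
        nlinarith
      linarith
    obtain ⟨k, hk, hkle⟩ : ∃ k ∈ Icc 1 L, 4+5*γ - s k ≤ 2/L := by
      by_contra! hc
      have hsub : Icc 1 L ⊆ Icc 1 K := Icc_subset_Icc_right hLK
      have b1 : ∑ k ∈ Icc 1 L, (4+5*γ - s k) ≤ D :=
        hD ▸ sum_le_sum_of_subset_of_nonneg hsub (fun k hk _ => by linarith [hQ k hk])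
      have b2 : ∑ k ∈ Icc 1 L, (2/L:ℝ) < ∑ k ∈ Icc 1 L, (4+5*γ - s k) :=
        sum_lt_sum_of_nonempty ⟨1, mem_Icc.2 ⟨le_rfl, hL1⟩⟩ hc
      rw [sum_const, nsmul_eq_mul, Nat.card_Icc] at b2
      have : ((L+1-1:ℕ):ℝ) * (2/L) = 2 := by
        rw [Nat.add_sub_cancel]; field_simp
      linarith
    have hkK : k ∈ Icc 1 K := Icc_subset_Icc_right hLK hk
    rw [mem_Icc] at hk
    have hk1 : (1:ℝ) ≤ k := by exact_mod_cast hk.1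
    have hkL : (k:ℝ) ≤ L := by exact_mod_cast hk.2
    have hθ1 : (2/L:ℝ) ≤ 1/10000 := by
      rw [div_le_iff₀ hL0]; linarith
    have hγθ : γ ≤ 2/L := by
      refine hγ.trans ?_
      rw [div_le_div_iff₀ (by positivity) hL0]
      nlinarith
    have key := pt_S (2/L) (l P2 k) (l P3 k) (l P4 k) (m P2 k) (m P3 k) (m P4 k) (by positivity) hθ1
      (l0 _ _) (l0 _ _) (l0 _ _) (m0 _ _) (m0 _ _) (m0 _ _) (lm1 _ _ c2)
      (lm1 _ _ c3) (lm1 _ _ c4) ((hpair _ _ h23 k hkK).trans (by linarith))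
      ((hpair _ _ h24 k hkK).trans (by linarith)) ((hpair _ _ h34 k hkK).trans (by linarith))
      (by rw [hs] at hkle; linarith)
    have e500 : 250*(2/L:ℝ) = 500/L := by ring
    rw [e500] at key
    refine ⟨k*h, by positivity, ?_, ?_⟩
    · rw [le_div_iff₀ (by positivity)]
      have : (k:ℝ)*h ≤ L * h := mul_le_mul_of_nonneg_right hkL hhp.le
      have : (L:ℝ)*h*(2*L) ≤ 1 := by rw [← hhK, hKR]; nlinarith
      nlinarith
    · rintro P (rfl | rfl | rfl) <;> rw [hlow]
      · exact ⟨mul_le_mul_of_nonneg_right key.1.1 hnR.le, mul_le_mul_of_nonneg_right key.1.2 hnR.le⟩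
      · exact ⟨mul_le_mul_of_nonneg_right key.2.1.1 hnR.le, mul_le_mul_of_nonneg_right key.2.1.2 hnR.le⟩
      · exact ⟨mul_le_mul_of_nonneg_right key.2.2.1 hnR.le, mul_le_mul_of_nonneg_right key.2.2.2 hnR.le⟩


lemma lp_duality {α : Type} [DecidableEq α] (V V1 : Finset α) (n : ℕ) (hn : 0 < n)
    (hV : V.card = 4*n) (hV1 : V1 ⊆ V) (hc1 : V1.card = n)
    (E : Finset (Finset α)) (hE : ∀ e ∈ E, e ⊆ V ∧ (e ∩ V1).card = 1)
    (hno : ∀ (w : α → ℝ) (c : ℝ), (∀ e ∈ E, c ≤ ∑ v ∈ e, w v) → n * c ≤ ∑ v ∈ V, w v) :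
    ∃ f : Finset α → ℝ, IsFracPM V E f ∧ {e : Finset α | e ∈ E ∧ 0 < f e}.ncard ≤ 4 * n := by
  have hnR : (0:ℝ) < n := by exact_mod_cast hn
  obtain ⟨ind, hind⟩ : ∃ ind : Finset α → (V → ℝ), ∀ e v, ind e v = if (v:α) ∈ e then 1 else 0 :=
    ⟨fun e v => if (v:α) ∈ e then 1 else 0, fun _ _ => rfl⟩
  set S : Set (V → ℝ) := ind '' (E : Set (Finset α)) with hS
  have hfin : S.Finite := (Finset.finite_toSet E).image _
  by_cases hp : (fun _ : V => (1/n : ℝ)) ∈ convexHull ℝ S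
  · obtain ⟨ι, _, z, w, hz, haff, hw, hw1, hwz⟩ := eq_pos_convex_span_of_mem_convexHull hp
    have hz' : ∀ i, ∃ e ∈ E, ind e = z i := by
      intro i
      have := hz ⟨i, rfl⟩
      simpa [hS] using this
    choose ed hedE hed using hz'
    have hinj : Function.Injective ed := by
      intro i j hij
      apply haff.injective
      rw [← hed, ← hed, hij]
    have hcoord : ∀ v ∈ V, ∑ i, (if v ∈ ed i then n * w i else 0) = 1 := by
      intro v hv
      have := congrFun hwz ⟨v, hv⟩
      simp only [Finset.sum_apply, Pi.smul_apply, smul_eq_mul, ← hed, hind] at this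
      have h2 : ∑ i, (if v ∈ ed i then n * w i else 0) =
          n * ∑ i, w i * (if v ∈ ed i then (1:ℝ) else 0) := by
        rw [mul_sum]
        apply sum_congr rfl
        intro i _
        split_ifs <;> simp
      rw [h2, this]
      field_simp
    classical
    obtain ⟨f, hf⟩ : ∃ f : Finset α → ℝ, ∀ e, f e = ∑ i, if ed i = e then n * w i else 0 :=
      ⟨_, fun _ => rfl⟩
    have hf0 : ∀ e, 0 ≤ f e := by
      intro e
      rw [hf]
      apply sum_nonneg
      intro i _
      split_ifs
      · exact (mul_pos hnR (hw i)).le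
      · exact le_rfl
    have hsum : ∀ v ∈ V, ∑ e ∈ E.filter (fun e => v ∈ e), f e = 1 := by
      intro v hv
      rw [← hcoord v hv]
      simp only [hf]
      rw [sum_comm]
      apply sum_congr rfl
      intro i _
      rw [sum_ite_eq]
      simp [hedE]
    refine ⟨f, ⟨?_, ?_, hsum⟩, ?_⟩
    · intro e he
      rw [hf]
      apply sum_eq_zero
      intro i _
      rw [if_neg]
      rintro rfl
      exact he (hedE i)
    · intro e he
      refine ⟨hf0 e, ?_⟩
      obtain ⟨h1, h2⟩ := hE e he
      obtain ⟨v, hv⟩ : (e ∩ V1).Nonempty := by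
        rw [← card_pos, h2]; norm_num
      have hve := (mem_inter.1 hv).1
      rw [← hsum v (h1 hve)]
      exact single_le_sum (f := f) (fun e _ => hf0 e) (mem_filter.2 ⟨he, hve⟩)
    · have hsub : {e : Finset α | e ∈ E ∧ 0 < f e} ⊆ ((univ.image ed : Finset (Finset α)) : Set (Finset α)) := by
        rintro e ⟨_, he⟩
        by_contra hc
        have : f e = 0 := by
          rw [hf]
          apply sum_eq_zero
          intro i _
          rw [if_neg]
          rintro rfl
          simp at hc
        linarith
      refine (Set.ncard_le_ncard hsub (Finset.finite_toSet _)).trans ?_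
      rw [Set.ncard_coe_finset]
      refine card_image_le.trans ?_
      rw [card_univ]
      -- dimension count
      let ψ : (V → ℝ) →ₗ[ℝ] ℝ := ∑ v : V, if (v:α) ∈ V1 then LinearMap.proj v else 0
      have hψ : ∀ g, ψ g = ∑ v : V, if (v:α) ∈ V1 then g v else 0 := by
        intro g
        simp only [ψ, LinearMap.sum_apply]
        apply sum_congr rfl
        intro v _
        split_ifs <;> simp
      have hψz : ∀ i, ψ (z i) = 1 := by
        intro i
        rw [hψ, ← hed]
        simp only [hind]
        have h2 := (hE _ (hedE i)).2
        have h1 := (hE _ (hedE i)).1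
        have : ∑ v : V, (if (v:α) ∈ V1 then (if (v:α) ∈ ed i then (1:ℝ) else 0) else 0) =
            ∑ v ∈ V, (if v ∈ V1 then (if v ∈ ed i then (1:ℝ) else 0) else 0) :=
          Finset.sum_coe_sort V (fun v => if v ∈ V1 then (if v ∈ ed i then (1:ℝ) else 0) else 0)
        rw [this]
        have h3 : ∀ v ∈ V, (if v ∈ V1 then (if v ∈ ed i then (1:ℝ) else 0) else 0) =
            if v ∈ ed i ∩ V1 then 1 else 0 := by
          intro v _
          simp only [mem_inter]
          split_ifs <;> simp_all
        rw [sum_congr rfl h3, sum_ite_mem, inter_eq_right.2 (inter_subset_left.trans h1)]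
        simp [h2]
      have hspan : vectorSpan ℝ (Set.range z) ≤ LinearMap.ker ψ := by
        rw [vectorSpan_def, Submodule.span_le]
        rintro _ ⟨_, ⟨i, rfl⟩, _, ⟨j, rfl⟩, rfl⟩
        simp [hψz]
      have hker : LinearMap.ker ψ < ⊤ := by
        rw [lt_top_iff_ne_top]
        intro htop
        rw [LinearMap.ker_eq_top] at htop
        have : Nonempty ι := by
          by_contra hne
          rw [not_nonempty_iff] at hne
          simp at hw1
        obtain ⟨i⟩ := this
        have := hψz i
        rw [htop] at this
        simp at this
      have hlt := Submodule.finrank_lt_finrank_of_lt (hspan.trans_lt hker)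
      rw [finrank_top, Module.finrank_fintype_fun_eq_card, Fintype.card_coe, hV] at hlt
      have := haff.card_le_finrank_succ
      omega
  · exfalso
    obtain ⟨φ, u, h1, h2⟩ := geometric_hahn_banach_point_closed (convex_convexHull ℝ S)
      (hfin.isClosed_convexHull ℝ) hp
    set w : α → ℝ := fun v => if h : v ∈ V then φ (Pi.single ⟨v, h⟩ 1) else 0 with hw
    have hφ : ∀ g : V → ℝ, φ g = ∑ v : V, g v * w v := by
      intro g
      conv_lhs => rw [← Finset.univ_sum_single g, map_sum]
      apply sum_congr rfl
      intro v _
      have : (Pi.single v (g v) : V → ℝ) = g v • Pi.single v 1 := by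
        rw [← Pi.single_smul]; simp
      rw [this, map_smul]
      simp [hw]
    have hA := hno w u (by
      intro e he
      have := h2 (ind e) (subset_convexHull ℝ S ⟨e, he, rfl⟩)
      rw [hφ] at this
      refine this.le.trans (le_of_eq ?_)
      simp only [hind, ite_mul, one_mul, zero_mul]
      rw [Finset.sum_coe_sort V (fun v => if v ∈ e then w v else 0), sum_ite_mem,
        inter_eq_right.2 (hE e he).1])
    rw [hφ] at h1
    rw [Finset.sum_coe_sort V (fun v => (1/n:ℝ) * w v), ← mul_sum] at h1
    rw [one_div, inv_mul_lt_iff₀ hnR] at h1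
    linarith


lemma edge_form {α : Type} [DecidableEq α] {V1 V2 V3 V4 e : Finset α}
    (hs : e ⊆ V1 ∪ V2 ∪ V3 ∪ V4) (h1 : (e ∩ V1).card = 1) (h2 : (e ∩ V2).card = 1)
    (h3 : (e ∩ V3).card = 1) (h4 : (e ∩ V4).card = 1) :
    ∃ x ∈ V1, ∃ a ∈ V2, ∃ b ∈ V3, ∃ c ∈ V4, e = {x, a, b, c} ∧
      e ∩ V1 = {x} ∧ e ∩ V2 = {a} ∧ e ∩ V3 = {b} ∧ e ∩ V4 = {c} := by
  obtain ⟨x, hx⟩ := card_eq_one.1 h1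
  obtain ⟨a, ha⟩ := card_eq_one.1 h2
  obtain ⟨b, hb⟩ := card_eq_one.1 h3
  obtain ⟨c, hc⟩ := card_eq_one.1 h4
  have mx : x ∈ e ∩ V1 := by rw [hx]; simp
  have ma : a ∈ e ∩ V2 := by rw [ha]; simp
  have mb : b ∈ e ∩ V3 := by rw [hb]; simp
  have mc : c ∈ e ∩ V4 := by rw [hc]; simp
  rw [mem_inter] at mx ma mb mc
  refine ⟨x, mx.2, a, ma.2, b, mb.2, c, mc.2, ?_, hx, ha, hb, hc⟩
  have : e = (e ∩ V1) ∪ (e ∩ V2) ∪ (e ∩ V3) ∪ (e ∩ V4) := by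
    rw [← inter_union_distrib_left, ← inter_union_distrib_left, ← inter_union_distrib_left,
      inter_eq_left.2 hs]
  rw [this, hx, ha, hb, hc]
  ext v
  simp only [mem_union, mem_singleton, mem_insert]
  tauto

lemma nonnbr2 {α : Type} [DecidableEq α] {V1 V2 V3 V4 : Finset α} {E : Finset (Finset α)}
    {n : ℕ} {γ : ℝ} (h3 : V3.card = n) (h4 : V4.card = n)
    (hE : IsPartite4 V1 V2 V3 V4 E) {x y : α} (hx : x ∈ V1) (hy : y ∈ V2)
    (hd : ((5 : ℝ) / 9 - γ) * n ^ 2 ≤ (hdeg2 E x y : ℝ)) :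
    (((V3 ×ˢ V4).filter (fun p => ({x, y, p.1, p.2} : Finset α) ∉ E)).card : ℝ)
      ≤ (4/9+γ)*n^2 := by
  have h1 : hdeg2 E x y ≤
      ((V3 ×ˢ V4).filter (fun p => ({x, y, p.1, p.2} : Finset α) ∈ E)).card := by
    have hi : (((V3 ×ˢ V4).filter (fun p => ({x, y, p.1, p.2} : Finset α) ∈ E)).image
      (fun p => ({x, y, p.1, p.2} : Finset α))).card ≤
      ((V3 ×ˢ V4).filter (fun p => ({x, y, p.1, p.2} : Finset α) ∈ E)).card := card_image_le
    refine le_trans ?_ hi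
    unfold hdeg2
    apply card_le_card
    intro e he
    rw [mem_filter] at he
    obtain ⟨heE, hxe, hye⟩ := he
    obtain ⟨hs, e1, e2, e3, e4⟩ := hE e heE
    obtain ⟨x', hx', a, ha, b, hb, c, hc, hform, f1, f2, f3, f4⟩ := edge_form hs e1 e2 e3 e4
    have g1 : x ∈ e ∩ V1 := mem_inter.2 ⟨hxe, hx⟩
    have g2 : y ∈ e ∩ V2 := mem_inter.2 ⟨hye, hy⟩
    rw [f1, mem_singleton] at g1
    rw [f2, mem_singleton] at g2
    subst g1 g2
    rw [mem_image]
    exact ⟨(b, c), mem_filter.2 ⟨mem_product.2 ⟨hb, hc⟩, hform ▸ heE⟩, hform.symm⟩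
  have h2 := card_filter_add_card_filter_not (s := V3 ×ˢ V4)
    (fun p => ({x, y, p.1, p.2} : Finset α) ∈ E)
  rw [card_product, h3, h4] at h2
  have h2' : (((V3 ×ˢ V4).filter (fun p => ({x, y, p.1, p.2} : Finset α) ∈ E)).card : ℝ) +
    ((V3 ×ˢ V4).filter (fun p => ({x, y, p.1, p.2} : Finset α) ∉ E)).card = n * n := by
    exact_mod_cast h2
  have h1' : (hdeg2 E x y : ℝ) ≤
      ((V3 ×ˢ V4).filter (fun p => ({x, y, p.1, p.2} : Finset α) ∈ E)).card := by
    exact_mod_cast h1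
  nlinarith

lemma partite_swap23 {α : Type} [DecidableEq α] {V1 V2 V3 V4 : Finset α} {E : Finset (Finset α)}
    (hE : IsPartite4 V1 V2 V3 V4 E) : IsPartite4 V1 V3 V2 V4 E := by
  intro e he
  obtain ⟨hs, e1, e2, e3, e4⟩ := hE e he
  exact ⟨by rwa [union_right_comm V1 V3 V2], e1, e3, e2, e4⟩

lemma partite_swap34 {α : Type} [DecidableEq α] {V1 V2 V3 V4 : Finset α} {E : Finset (Finset α)}
    (hE : IsPartite4 V1 V2 V3 V4 E) : IsPartite4 V1 V2 V4 V3 E := by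
  intro e he
  obtain ⟨hs, e1, e2, e3, e4⟩ := hE e he
  exact ⟨by rwa [union_right_comm (V1 ∪ V2) V4 V3], e1, e2, e4, e3⟩

lemma exists_W {α : Type} [DecidableEq α] (V Lo : Finset α) (hLo : Lo ⊆ V) (k : ℕ)
    (hk : k ≤ V.card) : ∃ W ⊆ V, W.card = k ∧
      ((V.filter (fun v => v ∈ Lo ↔ v ∈ W)).card : ℝ) ≤ |(k:ℝ) + Lo.card - V.card| := by
  have hc : (V \ Lo).card + Lo.card = V.card := card_sdiff_add_card_eq_card hLo
  rcases le_total k (V \ Lo).card with h | h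
  · obtain ⟨W, hW, hWk⟩ := exists_subset_card_eq h
    refine ⟨W, hW.trans sdiff_subset, hWk, ?_⟩
    have e : (V.filter (fun v => v ∈ Lo ↔ v ∈ W)) ⊆ (V \ Lo) \ W := by
      intro v hv
      rw [mem_filter] at hv
      simp only [mem_sdiff]
      by_cases h1 : v ∈ Lo
      · have := mem_sdiff.1 (hW (hv.2.1 h1)); tauto
      · tauto
    have h2 := card_le_card e
    have h3 := card_sdiff_add_card_eq_card hW
    have h4 : (V.filter (fun v => v ∈ Lo ↔ v ∈ W)).card + k + Lo.card ≤ V.card := by omega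
    have h5 : ((V.filter (fun v => v ∈ Lo ↔ v ∈ W)).card : ℝ) + k + Lo.card ≤ V.card := by
      exact_mod_cast h4
    refine le_trans ?_ (neg_le_abs _)
    linarith
  · obtain ⟨W, hW1, hW2, hWk⟩ := exists_subsuperset_card_eq (sdiff_subset (s := V) (t := Lo)) h hk
    refine ⟨W, hW2, hWk, ?_⟩
    have e : (V.filter (fun v => v ∈ Lo ↔ v ∈ W)) ⊆ W \ (V \ Lo) := by
      intro v hv
      rw [mem_filter] at hv
      simp only [mem_sdiff]
      by_cases h1 : v ∈ Lo
      · tauto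
      · have := hW1 (mem_sdiff.2 ⟨hv.1, h1⟩); tauto
    have h2 := card_le_card e
    have h3 := card_sdiff_add_card_eq_card hW1
    have h4 : (V.filter (fun v => v ∈ Lo ↔ v ∈ W)).card + V.card ≤ k + Lo.card := by omega
    have h5 : ((V.filter (fun v => v ∈ Lo ↔ v ∈ W)).card : ℝ) + V.card ≤ k + Lo.card := by
      exact_mod_cast h4
    refine le_trans ?_ (le_abs_self _)
    linarith

lemma biUnion_bound {α : Type} [DecidableEq α] (A B : Finset α) (n : ℕ) (r : ℝ) (hr : 0 ≤ r)
    (hA : A.card ≤ n) (hB : B.card ≤ n) (F : α × α → Finset (α × α))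
    (g : α × α → α × α → Finset α)
    (hF : ∀ p ∈ A ×ˢ B, ((F p).card : ℝ) ≤ r) :
    (((A ×ˢ B).biUnion (fun p => (F p).image (g p))).card : ℝ) ≤ n^2 * r := by
  have h1 : (((A ×ˢ B).biUnion (fun p => (F p).image (g p))).card : ℝ) ≤
      ∑ p ∈ A ×ˢ B, (((F p).image (g p)).card : ℝ) := by
    exact_mod_cast card_biUnion_le
  have h2 : ∑ p ∈ A ×ˢ B, (((F p).image (g p)).card : ℝ) ≤ ∑ p ∈ A ×ˢ B, r := by
    apply sum_le_sum
    intro p hp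
    refine le_trans ?_ (hF p hp)
    exact_mod_cast card_image_le
  rw [sum_const, nsmul_eq_mul, card_product] at h2
  refine h1.trans (h2.trans (mul_le_mul_of_nonneg_right ?_ hr))
  have : A.card * B.card ≤ n * n := Nat.mul_le_mul hA hB
  rw [pow_two]
  exact_mod_cast this

lemma image4_bound {α : Type} [DecidableEq α] (A B C D : Finset α)
    (g : α × α × α × α → Finset α) :
    (((A ×ˢ B ×ˢ C ×ˢ D).image g).card : ℝ) ≤ A.card * (B.card * (C.card * D.card)) := by
  have h : ((A ×ˢ B ×ˢ C ×ˢ D).image g).card ≤ (A ×ˢ B ×ˢ C ×ˢ D).card := card_image_le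
  rw [card_product, card_product, card_product] at h
  exact_mod_cast h

set_option maxHeartbeats 2000000 in
lemma count_close {α : Type} [DecidableEq α] {V1 V2 V3 V4 : Finset α} {E : Finset (Finset α)}
    {n : ℕ} (c1 : V1.card = n) (c2 : V2.card = n) (c3 : V3.card = n) (c4 : V4.card = n)
    (d23 : Disjoint V2 V3) (d24 : Disjoint V2 V4) (d34 : Disjoint V3 V4)
    (G L2 L3 L4 W2 W3 W4 : Finset α) (hG : G ⊆ V1) (hL2 : L2 ⊆ V2) (hL3 : L3 ⊆ V3) (hL4 : L4 ⊆ V4)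
    (hW2 : W2 ⊆ V2) (hW3 : W3 ⊆ V3) (hW4 : W4 ⊆ V4)
    (β δ η : ℝ) (hη : 0 ≤ η) (hB : ((V1 \ G).card : ℝ) ≤ β * n)
    (hD2 : ((V2.filter (fun v => v ∈ L2 ↔ v ∈ W2)).card : ℝ) ≤ δ * n)
    (hD3 : ((V3.filter (fun v => v ∈ L3 ↔ v ∈ W3)).card : ℝ) ≤ δ * n)
    (hD4 : ((V4.filter (fun v => v ∈ L4 ↔ v ∈ W4)).card : ℝ) ≤ δ * n)
    (hN2 : ∀ x ∈ G, ∀ y ∈ L2, (((V3 ×ˢ V4).filter (fun p => ¬ (p.1 ∈ L3 ∧ p.2 ∈ L4) ∧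
      ({x, y, p.1, p.2} : Finset α) ∉ E)).card : ℝ) ≤ η * n^2)
    (hN3 : ∀ x ∈ G, ∀ y ∈ L3, (((V2 ×ˢ V4).filter (fun p => ¬ (p.1 ∈ L2 ∧ p.2 ∈ L4) ∧
      ({x, p.1, y, p.2} : Finset α) ∉ E)).card : ℝ) ≤ η * n^2)
    (hN4 : ∀ x ∈ G, ∀ y ∈ L4, (((V2 ×ˢ V3).filter (fun p => ¬ (p.1 ∈ L2 ∧ p.2 ∈ L3) ∧
      ({x, p.1, p.2, y} : Finset α) ∉ E)).card : ℝ) ≤ η * n^2) :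
    (((H13edges V1 V2 V3 V4 W2 W3 W4) \ E).card : ℝ) ≤ (β + 3*δ + 3*η) * n^4 := by
  set q : α × α × α × α → Finset α := fun p => {p.1, p.2.1, p.2.2.1, p.2.2.2} with hq
  set D2 := V2.filter (fun v => v ∈ L2 ↔ v ∈ W2) with hD2'
  set D3 := V3.filter (fun v => v ∈ L3 ↔ v ∈ W3) with hD3'
  set D4 := V4.filter (fun v => v ∈ L4 ↔ v ∈ W4) with hD4'
  set T1 := ((V1 \ G) ×ˢ V2 ×ˢ V3 ×ˢ V4).image q with hT1
  set T2 := (V1 ×ˢ D2 ×ˢ V3 ×ˢ V4).image q with hT2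
  set T3 := (V1 ×ˢ V2 ×ˢ D3 ×ˢ V4).image q with hT3
  set T4 := (V1 ×ˢ V2 ×ˢ V3 ×ˢ D4).image q with hT4
  set S2 := (G ×ˢ L2).biUnion (fun r => ((V3 ×ˢ V4).filter (fun p => ¬ (p.1 ∈ L3 ∧ p.2 ∈ L4) ∧
      ({r.1, r.2, p.1, p.2} : Finset α) ∉ E)).image
      (fun p => ({r.1, r.2, p.1, p.2} : Finset α))) with hS2
  set S3 := (G ×ˢ L3).biUnion (fun r => ((V2 ×ˢ V4).filter (fun p => ¬ (p.1 ∈ L2 ∧ p.2 ∈ L4) ∧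
      ({r.1, p.1, r.2, p.2} : Finset α) ∉ E)).image
      (fun p => ({r.1, p.1, r.2, p.2} : Finset α))) with hS3
  set S4 := (G ×ˢ L4).biUnion (fun r => ((V2 ×ˢ V3).filter (fun p => ¬ (p.1 ∈ L2 ∧ p.2 ∈ L3) ∧
      ({r.1, p.1, p.2, r.2} : Finset α) ∉ E)).image
      (fun p => ({r.1, p.1, p.2, r.2} : Finset α))) with hS4
  have hcov : (H13edges V1 V2 V3 V4 W2 W3 W4) \ E ⊆ T1 ∪ T2 ∪ T3 ∪ T4 ∪ S2 ∪ S3 ∪ S4 := by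
    intro e he
    rw [mem_sdiff, H13edges, mem_filter, mem_powerset] at he
    obtain ⟨⟨hs, e1, e2, e3, e4, hWne, hUne⟩, heE⟩ := he
    obtain ⟨x, hx, a, ha, b, hb, c, hc, hform, f1, f2, f3, f4⟩ := edge_form hs e1 e2 e3 e4
    simp only [mem_union]
    by_cases hxG : x ∈ G
    swap
    · have : e ∈ T1 := mem_image.2 ⟨(x, a, b, c), by simp [hx, hxG, ha, hb, hc], hform.symm⟩
      simp only [this, true_or, or_true]
    by_cases haD : a ∈ D2
    · have : e ∈ T2 := mem_image.2 ⟨(x, a, b, c), by simp [hx, haD, hb, hc], hform.symm⟩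
      simp only [this, true_or, or_true]
    by_cases hbD : b ∈ D3
    · have : e ∈ T3 := mem_image.2 ⟨(x, a, b, c), by simp [hx, hbD, ha, hc], hform.symm⟩
      simp only [this, true_or, or_true]
    by_cases hcD : c ∈ D4
    · have : e ∈ T4 := mem_image.2 ⟨(x, a, b, c), by simp [hx, hcD, ha, hb], hform.symm⟩
      simp only [this, true_or, or_true]
    have haD' : ¬ (a ∈ L2 ↔ a ∈ W2) := fun h => haD (mem_filter.2 ⟨ha, h⟩)
    have hbD' : ¬ (b ∈ L3 ↔ b ∈ W3) := fun h => hbD (mem_filter.2 ⟨hb, h⟩)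
    have hcD' : ¬ (c ∈ L4 ↔ c ∈ W4) := fun h => hcD (mem_filter.2 ⟨hc, h⟩)
    have key : ∀ v ∈ e, (v ∈ V2 → v = a) ∧ (v ∈ V3 → v = b) ∧ (v ∈ V4 → v = c) := by
      intro v hv
      refine ⟨fun h => ?_, fun h => ?_, fun h => ?_⟩
      · have := mem_inter.2 ⟨hv, h⟩
        rwa [f2, mem_singleton] at this
      · have := mem_inter.2 ⟨hv, h⟩
        rwa [f3, mem_singleton] at this
      · have := mem_inter.2 ⟨hv, h⟩
        rwa [f4, mem_singleton] at this
    have hW : a ∈ W2 ∨ b ∈ W3 ∨ c ∈ W4 := by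
      obtain ⟨v, hv⟩ := hWne
      rw [mem_inter, mem_union, mem_union] at hv
      obtain ⟨hve, (h | h) | h⟩ := hv
      · left; rwa [← (key v hve).1 (hW2 h)]
      · right; left; rwa [← (key v hve).2.1 (hW3 h)]
      · right; right; rwa [← (key v hve).2.2 (hW4 h)]
    have hU : a ∉ W2 ∨ b ∉ W3 ∨ c ∉ W4 := by
      obtain ⟨v, hv⟩ := hUne
      simp only [mem_inter, mem_union, mem_sdiff] at hv
      obtain ⟨hve, (h | h) | h⟩ := hv
      · left; rw [← (key v hve).1 h.1]; exact h.2
      · right; left; rw [← (key v hve).2.1 h.1]; exact h.2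
      · right; right; rw [← (key v hve).2.2 h.1]; exact h.2
    by_cases haL : a ∈ L2
    · have : e ∈ S2 := by
        refine mem_biUnion.2 ⟨(x, a), mem_product.2 ⟨hxG, haL⟩, mem_image.2 ⟨(b, c), ?_, hform.symm⟩⟩
        refine mem_filter.2 ⟨mem_product.2 ⟨hb, hc⟩, ?_, by rwa [hform] at heE⟩
        dsimp only
        tauto
      simp only [this, true_or, or_true]
    by_cases hbL : b ∈ L3
    · have : e ∈ S3 := by
        refine mem_biUnion.2 ⟨(x, b), mem_product.2 ⟨hxG, hbL⟩, mem_image.2 ⟨(a, c), ?_, hform.symm⟩⟩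
        refine mem_filter.2 ⟨mem_product.2 ⟨ha, hc⟩, ?_, by rwa [hform] at heE⟩
        dsimp only
        tauto
      simp only [this, true_or, or_true]
    have : e ∈ S4 := by
      refine mem_biUnion.2 ⟨(x, c), mem_product.2 ⟨hxG, ?_⟩, mem_image.2 ⟨(a, b), ?_, hform.symm⟩⟩
      · dsimp only
        tauto
      refine mem_filter.2 ⟨mem_product.2 ⟨ha, hb⟩, ?_, by rwa [hform] at heE⟩
      dsimp only
      tauto
    simp only [this, true_or, or_true]
  have hr : 0 ≤ η * (n:ℝ)^2 := by positivity
  have b2 : (S2.card : ℝ) ≤ n^2 * (η * n^2) := by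
    refine biUnion_bound G L2 n _ hr (c1 ▸ card_le_card hG) (c2 ▸ card_le_card hL2) _ _ ?_
    rintro ⟨x, y⟩ hp
    rw [mem_product] at hp
    exact hN2 x hp.1 y hp.2
  have b3 : (S3.card : ℝ) ≤ n^2 * (η * n^2) := by
    refine biUnion_bound G L3 n _ hr (c1 ▸ card_le_card hG) (c3 ▸ card_le_card hL3) _ _ ?_
    rintro ⟨x, y⟩ hp
    rw [mem_product] at hp
    exact hN3 x hp.1 y hp.2
  have b4 : (S4.card : ℝ) ≤ n^2 * (η * n^2) := by
    refine biUnion_bound G L4 n _ hr (c1 ▸ card_le_card hG) (c4 ▸ card_le_card hL4) _ _ ?_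
    rintro ⟨x, y⟩ hp
    rw [mem_product] at hp
    exact hN4 x hp.1 y hp.2
  have hn3 : (0:ℝ) ≤ (n:ℝ)^3 := by positivity
  have t1 : (T1.card : ℝ) ≤ β * n^4 := by
    have := image4_bound (V1 \ G) V2 V3 V4 q
    rw [c2, c3, c4] at this
    have h := mul_le_mul_of_nonneg_right hB hn3
    linarith
  have t2 : (T2.card : ℝ) ≤ δ * n^4 := by
    have := image4_bound V1 D2 V3 V4 q
    rw [c1, c3, c4] at this
    have h := mul_le_mul_of_nonneg_right hD2 hn3
    linarith
  have t3 : (T3.card : ℝ) ≤ δ * n^4 := by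
    have := image4_bound V1 V2 D3 V4 q
    rw [c1, c2, c4] at this
    have h := mul_le_mul_of_nonneg_right hD3 hn3
    linarith
  have t4 : (T4.card : ℝ) ≤ δ * n^4 := by
    have := image4_bound V1 V2 V3 D4 q
    rw [c1, c2, c3] at this
    have h := mul_le_mul_of_nonneg_right hD4 hn3
    linarith
  have hfin : ((H13edges V1 V2 V3 V4 W2 W3 W4) \ E).card ≤
      T1.card + T2.card + T3.card + T4.card + S2.card + S3.card + S4.card := by
    refine (card_le_card hcov).trans ?_
    refine (card_union_le _ _).trans (Nat.add_le_add_right ?_ _)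
    refine (card_union_le _ _).trans (Nat.add_le_add_right ?_ _)
    refine (card_union_le _ _).trans (Nat.add_le_add_right ?_ _)
    refine (card_union_le _ _).trans (Nat.add_le_add_right ?_ _)
    refine (card_union_le _ _).trans (Nat.add_le_add_right ?_ _)
    exact card_union_le _ _
  have hfin' : (((H13edges V1 V2 V3 V4 W2 W3 W4) \ E).card : ℝ) ≤
      T1.card + T2.card + T3.card + T4.card + S2.card + S3.card + S4.card := by
    exact_mod_cast hfin
  linarith


lemma low_pairs {α : Type} [DecidableEq α] (A B LA LB : Finset α) (n : ℕ) (L γ : ℝ)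
    (hL : 20000 ≤ L) (hγ : γ ≤ 1/(5*L^2)) (hA : LA ⊆ A) (hB : LB ⊆ B)
    (Q : α × α → Prop) [DecidablePred Q]
    (hlow : ∀ a ∈ LA, ∀ b ∈ LB, Q (a, b))
    (hc : (((A ×ˢ B).filter Q).card : ℝ) ≤ (4/9+γ)*n^2)
    (hcA : (2/3-500/L)*n ≤ (LA.card : ℝ)) (hcB : (2/3-500/L)*n ≤ (LB.card : ℝ)) :
    (((A ×ˢ B).filter (fun p => ¬(p.1 ∈ LA ∧ p.2 ∈ LB) ∧ Q p)).card : ℝ) ≤ (668/L)*n^2 := by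
  have hsub : ((A ×ˢ B).filter (fun p => ¬(p.1 ∈ LA ∧ p.2 ∈ LB) ∧ Q p)) ∪ (LA ×ˢ LB) ⊆
      (A ×ˢ B).filter Q := by
    intro p hp
    rw [mem_union] at hp
    rcases hp with hp | hp
    · rw [mem_filter] at hp ⊢
      exact ⟨hp.1, hp.2.2⟩
    · rw [mem_product] at hp
      rw [mem_filter, mem_product]
      exact ⟨⟨hA hp.1, hB hp.2⟩, hlow _ hp.1 _ hp.2⟩
  have hdis : Disjoint ((A ×ˢ B).filter (fun p => ¬(p.1 ∈ LA ∧ p.2 ∈ LB) ∧ Q p)) (LA ×ˢ LB) := by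
    rw [Finset.disjoint_left]
    intro p hp hq
    rw [mem_filter] at hp
    rw [mem_product] at hq
    exact hp.2.1 hq
  have h1 := card_le_card hsub
  rw [card_union_of_disjoint hdis, card_product] at h1
  have h2 : (((A ×ˢ B).filter (fun p => ¬(p.1 ∈ LA ∧ p.2 ∈ LB) ∧ Q p)).card : ℝ) +
      LA.card * LB.card ≤ ((A ×ˢ B).filter Q).card := by exact_mod_cast h1
  have hL0 : 0 < L := by linarith
  have i1 : 500/L ≤ 1/40 := by
    rw [div_le_iff₀ hL0]; linarith
  have hn0 : (0:ℝ) ≤ n := Nat.cast_nonneg n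
  have h3 : ((2/3-500/L)*n)*((2/3-500/L)*n) ≤ (LA.card : ℝ) * LB.card := by
    apply mul_le_mul hcA hcB
    · apply mul_nonneg _ hn0; linarith
    · exact Nat.cast_nonneg _
  have h4 : 1/(5*L^2) ≤ 1/L := by
    apply one_div_le_one_div_of_le hL0
    nlinarith
  have h5 : 500/L = 500*(1/L) := by ring
  have h6 : 668/L = 668*(1/L) := by ring
  rw [h5] at h3
  rw [h6]
  have h7 : 0 < 1/L := by positivity
  set s := 1/L
  have h8 : (4/9+γ) - (2/3-500*s)^2 ≤ 668*s := by nlinarith [sq_nonneg s]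
  have h9 := mul_le_mul_of_nonneg_right h8 (sq_nonneg (n:ℝ))
  nlinarith

lemma w_bound {α : Type} [DecidableEq α] (V Lo : Finset α) (hLo : Lo ⊆ V) (n k : ℕ) (L : ℝ)
    (hL : 20000 ≤ L) (hn : L ≤ n) (hV : V.card = n) (hk1 : k ≤ n) (hk2 : n ≤ 3*k + 2)
    (hk3 : 3*k ≤ n+2)
    (h1 : (2/3-500/L)*n ≤ (Lo.card : ℝ)) (h2 : (Lo.card : ℝ) ≤ (2/3+500/L)*n) :
    ∃ W ⊆ V, W.card = k ∧
      ((V.filter (fun v => v ∈ Lo ↔ v ∈ W)).card : ℝ) ≤ (501/L)*n := by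
  obtain ⟨W, hW, hWk, h⟩ := exists_W V Lo hLo k (hV ▸ hk1)
  refine ⟨W, hW, hWk, h.trans ?_⟩
  rw [hV]
  have hL0 : 0 < L := by linarith
  have a : (n:ℝ) ≤ 3*k+2 := by exact_mod_cast hk2
  have b : (3:ℝ)*k ≤ n+2 := by exact_mod_cast hk3
  have c : 1 ≤ (1/L)*n := by
    rw [one_div, ← div_eq_inv_mul, le_div_iff₀ hL0]; linarith
  have h5 : 500/L = 500*(1/L) := by ring
  have h6 : 501/L = 501*(1/L) := by ring
  rw [h5] at h1 h2
  rw [h6, abs_le]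
  constructor <;> nlinarith

lemma close_core {α : Type} [DecidableEq α] {V1 V2 V3 V4 : Finset α} {E : Finset (Finset α)}
    {n L : ℕ} {γ ε : ℝ} (hL : (20000:ℝ) ≤ L) (hγ0 : 0 ≤ γ) (hγ : γ ≤ 1/(5*(L:ℝ)^2))
    (hn : L ≤ n) (hε : 3508/(L:ℝ) ≤ ε)
    (c1 : V1.card = n) (c2 : V2.card = n) (c3 : V3.card = n) (c4 : V4.card = n)
    (d23 : Disjoint V2 V3) (d24 : Disjoint V2 V4) (d34 : Disjoint V3 V4)
    (N2 : ∀ x ∈ V1, ∀ y ∈ V2, (((V3 ×ˢ V4).filter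
      (fun p => ({x, y, p.1, p.2} : Finset α) ∉ E)).card : ℝ) ≤ (4/9+γ)*n^2)
    (N3 : ∀ x ∈ V1, ∀ y ∈ V3, (((V2 ×ˢ V4).filter
      (fun p => ({x, p.1, y, p.2} : Finset α) ∉ E)).card : ℝ) ≤ (4/9+γ)*n^2)
    (N4 : ∀ x ∈ V1, ∀ y ∈ V4, (((V2 ×ˢ V3).filter
      (fun p => ({x, p.1, p.2, y} : Finset α) ∉ E)).card : ℝ) ≤ (4/9+γ)*n^2)
    (u μ : α → ℝ) (u2 : ∀ y ∈ V2, 0 ≤ u y) (u3 : ∀ y ∈ V3, 0 ≤ u y) (u4 : ∀ y ∈ V4, 0 ≤ u y)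
    (y2 y3 y4 x0 : α) (hy2 : y2 ∈ V2) (hy3 : y3 ∈ V3) (hy4 : y4 ∈ V4) (hx0 : x0 ∈ V1)
    (z2 : u y2 = 0) (z3 : u y3 = 0) (z4 : u y4 = 0) (hμ0 : μ x0 = 1)
    (hμ1 : ∀ x ∈ V1, μ x ≤ 1)
    (hed : ∀ x ∈ V1, ∀ a ∈ V2, ∀ b ∈ V3, ∀ c ∈ V4, ({x, a, b, c} : Finset α) ∈ E →
      μ x ≤ u a + u b + u c)
    (hsum : ∑ y ∈ V2, u y + ∑ y ∈ V3, u y + ∑ y ∈ V4, u y ≤ ∑ x ∈ V1, μ x) :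
    CloseToH13 ε n V1 V2 V3 V4 E := by
  have hL' : 20000 ≤ L := by exact_mod_cast hL
  have hnL : (L:ℝ) ≤ n := by exact_mod_cast hn
  have hn0 : 0 < n := by omega
  clear hL'
  have hμn : ∑ x ∈ V1, μ x ≤ n := by
    have := Finset.sum_le_card_nsmul V1 μ 1 hμ1
    rw [c1] at this
    simpa using this
  have h34 : (((V3 ×ˢ V4).filter (fun p => u p.1 + u p.2 < 1)).card : ℝ) ≤ (4/9+γ)*n^2 := by
    refine le_trans ?_ (N2 x0 hx0 y2 hy2)
    norm_cast
    apply card_le_card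
    intro p hp
    rw [mem_filter, mem_product] at hp
    rw [mem_filter, mem_product]
    refine ⟨hp.1, fun h => ?_⟩
    have := hed x0 hx0 y2 hy2 _ hp.1.1 _ hp.1.2 h
    linarith [hp.2]
  have h24 : (((V2 ×ˢ V4).filter (fun p => u p.1 + u p.2 < 1)).card : ℝ) ≤ (4/9+γ)*n^2 := by
    refine le_trans ?_ (N3 x0 hx0 y3 hy3)
    norm_cast
    apply card_le_card
    intro p hp
    rw [mem_filter, mem_product] at hp
    rw [mem_filter, mem_product]
    refine ⟨hp.1, fun h => ?_⟩
    have := hed x0 hx0 _ hp.1.1 y3 hy3 _ hp.1.2 h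
    linarith [hp.2]
  have h23 : (((V2 ×ˢ V3).filter (fun p => u p.1 + u p.2 < 1)).card : ℝ) ≤ (4/9+γ)*n^2 := by
    refine le_trans ?_ (N4 x0 hx0 y4 hy4)
    norm_cast
    apply card_le_card
    intro p hp
    rw [mem_filter, mem_product] at hp
    rw [mem_filter, mem_product]
    refine ⟨hp.1, fun h => ?_⟩
    have := hed x0 hx0 _ hp.1.1 _ hp.1.2 y4 hy4 h
    linarith [hp.2]
  obtain ⟨hs, t, ht0, ht, hlow⟩ := analytic V2 V3 V4 u n L γ hn0 (by exact_mod_cast hL) hγ0 hγ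
    c2 c3 c4 u2 u3 u4 h23 h24 h34 (hsum.trans hμn)
  obtain ⟨l2, l2'⟩ := hlow V2 (Or.inl rfl)
  obtain ⟨l3, l3'⟩ := hlow V3 (Or.inr (Or.inl rfl))
  obtain ⟨l4, l4'⟩ := hlow V4 (Or.inr (Or.inr rfl))
  have s2 : lowS V2 u t ⊆ V2 := filter_subset _ _
  have s3 : lowS V3 u t ⊆ V3 := filter_subset _ _
  have s4 : lowS V4 u t ⊆ V4 := filter_subset _ _
  obtain ⟨W2, w2, k2, D2⟩ := w_bound V2 _ s2 n (n/3) L hL hnL c2 (by omega) (by omega) (by omega)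
    l2 l2'
  obtain ⟨W3, w3, k3, D3⟩ := w_bound V3 _ s3 n ((n+1)/3) L hL hnL c3 (by omega) (by omega)
    (by omega) l3 l3'
  obtain ⟨W4, w4, k4, D4⟩ := w_bound V4 _ s4 n ((n+2)/3) L hL hnL c4 (by omega) (by omega)
    (by omega) l4 l4'
  have hL0 : (0:ℝ) < L := by linarith
  have hr0 : 0 < 1/(L:ℝ) := by positivity
  have hr1 : 1/(L:ℝ) ≤ 1/20000 := one_div_le_one_div_of_le (by norm_num) hL
  have ht2 : 2*t ≤ 1/(L:ℝ) := by
    have : 1/(2*(L:ℝ)) = (1/(L:ℝ))/2 := by field_simp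
    rw [this] at ht; linarith
  let G := V1.filter (fun x => 1 - 1/(L:ℝ) ≤ μ x)
  have hG : G ⊆ V1 := filter_subset _ _
  have hB : ((V1 \ G).card : ℝ) ≤ (1/(L:ℝ)) * n := by
    have e1 : ∑ x ∈ V1, (1/(L:ℝ)) * (if x ∈ V1 \ G then (1:ℝ) else 0) ≤ ∑ x ∈ V1, (1 - μ x) := by
      apply sum_le_sum
      intro x hx
      split_ifs with h
      · rw [mem_sdiff] at h
        have : ¬ (1 - 1/(L:ℝ) ≤ μ x) := fun h' => h.2 (mem_filter.2 ⟨hx, h'⟩)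
        linarith
      · linarith [hμ1 x hx]
    rw [← mul_sum, ← sum_filter, sum_const, sum_sub_distrib, sum_const, c1] at e1
    have e2 : V1.filter (fun x => x ∈ V1 \ G) = V1 \ G := by
      ext x; simp
    rw [e2] at e1
    simp only [nsmul_eq_mul, mul_one] at e1
    have e3 : 1/(L:ℝ)^2 = (1/L)*(1/(L:ℝ)) := by field_simp
    rw [e3] at hs
    have e4 : (1/(L:ℝ)) * ((V1 \ G).card:ℝ) ≤ (1/(L:ℝ)) * ((1/(L:ℝ)) * n) := by nlinarith
    exact le_of_mul_le_mul_left e4 hr0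
  have hne : ∀ x ∈ G, ∀ a ∈ lowS V2 u t, ∀ b ∈ lowS V3 u t, ∀ c ∈ lowS V4 u t,
      ({x, a, b, c} : Finset α) ∉ E := by
    intro x hx a ha b hb c hc h
    have hx' := (mem_filter.1 hx).2
    have ha' := (mem_filter.1 ha).2
    have hb' := (mem_filter.1 hb).2
    have hc' := (mem_filter.1 hc).2
    have := hed x (hG hx) a (s2 ha) b (s3 hb) c (s4 hc) h
    linarith
  refine ⟨W2, W3, W4, ⟨w2, w3, w4, ?_, ?_, ?_, ?_⟩, ?_⟩
  · omega
  · omega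
  · omega
  · omega
  have := count_close (E := E) c1 c2 c3 c4 d23 d24 d34 G (lowS V2 u t) (lowS V3 u t) (lowS V4 u t)
    W2 W3 W4 hG s2 s3 s4 w2 w3 w4 (1/(L:ℝ)) (501/(L:ℝ)) (668/(L:ℝ)) (by positivity) hB D2 D3 D4
    (fun x hx y hy => low_pairs V3 V4 _ _ n L γ hL hγ s3 s4 _
      (fun b hb c hc => hne x hx y hy b hb c hc) (N2 x (hG hx) y (s2 hy)) l3 l4)
    (fun x hx y hy => low_pairs V2 V4 _ _ n L γ hL hγ s2 s4 _
      (fun b hb c hc => hne x hx b hb y hy c hc) (N3 x (hG hx) y (s3 hy)) l2 l4)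
    (fun x hx y hy => low_pairs V2 V3 _ _ n L γ hL hγ s2 s3 _
      (fun b hb c hc => hne x hx b hb c hc y hy) (N4 x (hG hx) y (s4 hy)) l2 l3)
  refine this.trans ?_
  apply mul_le_mul_of_nonneg_right _ (by positivity)
  refine le_trans (le_of_eq ?_) hε
  ring


lemma no_dual {α : Type} [DecidableEq α] {V1 V2 V3 V4 : Finset α} {E : Finset (Finset α)}
    {n L : ℕ} {γ ε : ℝ} (hL : (20000:ℝ) ≤ L) (hγ0 : 0 ≤ γ) (hγ : γ ≤ 1/(5*(L:ℝ)^2))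
    (hn : L ≤ n) (hε : 3508/(L:ℝ) ≤ ε)
    (d12 : Disjoint V1 V2) (d13 : Disjoint V1 V3) (d14 : Disjoint V1 V4)
    (d23 : Disjoint V2 V3) (d24 : Disjoint V2 V4) (d34 : Disjoint V3 V4)
    (c1 : V1.card = n) (c2 : V2.card = n) (c3 : V3.card = n) (c4 : V4.card = n)
    (hE : IsPartite4 V1 V2 V3 V4 E)
    (hclose : ¬ CloseToH13 ε n V1 V2 V3 V4 E)
    (hdeg : ∀ x ∈ V1, ∀ y ∈ V2 ∪ V3 ∪ V4, ((5 : ℝ) / 9 - γ) * n ^ 2 ≤ (hdeg2 E x y : ℝ))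
    (w : α → ℝ) (c : ℝ) (hw : ∀ e ∈ E, c ≤ ∑ v ∈ e, w v) :
    n * c ≤ ∑ v ∈ V1 ∪ V2 ∪ V3 ∪ V4, w v := by
  by_contra hlt
  rw [not_le] at hlt
  have hLn : (0:ℝ) < L := by linarith
  have hn0 : 0 < n := lt_of_lt_of_le (by exact_mod_cast hLn) hn
  have ne : ∀ {V : Finset α}, V.card = n → V.Nonempty := fun h => card_pos.1 (h ▸ hn0)
  obtain ⟨y2, hy2, m2⟩ := exists_min_image V2 w (ne c2)
  obtain ⟨y3, hy3, m3⟩ := exists_min_image V3 w (ne c3)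
  obtain ⟨y4, hy4, m4⟩ := exists_min_image V4 w (ne c4)
  obtain ⟨x0, hx0, mx⟩ := exists_max_image V1 (fun x => c - w x - w y2 - w y3 - w y4) (ne c1)
  rw [sum_union (by simp [disjoint_union_left, *]), sum_union (by simp [disjoint_union_left, *]),
    sum_union d12] at hlt
  let v : α → ℝ := fun v => if v ∈ V2 then w v - w y2 else if v ∈ V3 then w v - w y3
    else w v - w y4
  have v2 : ∀ y ∈ V2, v y = w y - w y2 := fun y hy => by simp [v, hy]
  have v3 : ∀ y ∈ V3, v y = w y - w y3 := fun y hy => by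
    have : y ∉ V2 := fun h => Finset.disjoint_left.1 d23 h hy
    simp [v, hy, this]
  have v4 : ∀ y ∈ V4, v y = w y - w y4 := fun y hy => by
    have h2 : y ∉ V2 := fun h => Finset.disjoint_left.1 d24 h hy
    have h3 : y ∉ V3 := fun h => Finset.disjoint_left.1 d34 h hy
    simp [v, h2, h3]
  have S2 : ∑ y ∈ V2, v y = ∑ y ∈ V2, w y - n * w y2 := by
    rw [sum_congr rfl v2, sum_sub_distrib, sum_const, c2, nsmul_eq_mul]
  have S3 : ∑ y ∈ V3, v y = ∑ y ∈ V3, w y - n * w y3 := by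
    rw [sum_congr rfl v3, sum_sub_distrib, sum_const, c3, nsmul_eq_mul]
  have S4 : ∑ y ∈ V4, v y = ∑ y ∈ V4, w y - n * w y4 := by
    rw [sum_congr rfl v4, sum_sub_distrib, sum_const, c4, nsmul_eq_mul]
  have S1 : ∑ x ∈ V1, (c - w x - w y2 - w y3 - w y4) =
      n * c - ∑ x ∈ V1, w x - n * w y2 - n * w y3 - n * w y4 := by
    simp only [sum_sub_distrib, sum_const, c1, nsmul_eq_mul]
  have p2 : ∀ y ∈ V2, 0 ≤ v y := fun y hy => by rw [v2 y hy]; linarith [m2 y hy]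
  have p3 : ∀ y ∈ V3, 0 ≤ v y := fun y hy => by rw [v3 y hy]; linarith [m3 y hy]
  have p4 : ∀ y ∈ V4, 0 ≤ v y := fun y hy => by rw [v4 y hy]; linarith [m4 y hy]
  have q2 := sum_nonneg p2
  have q3 := sum_nonneg p3
  have q4 := sum_nonneg p4
  set M := c - w x0 - w y2 - w y3 - w y4 with hM
  have hMpos : 0 < M := by
    by_contra h
    rw [not_lt] at h
    have : ∑ x ∈ V1, (c - w x - w y2 - w y3 - w y4) ≤ 0 :=
      sum_nonpos (fun x hx => (mx x hx).trans h)
    linarith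
  apply hclose
  refine close_core (u := fun y => v y / M) (μ := fun x => (c - w x - w y2 - w y3 - w y4) / M)
    hL hγ0 hγ hn hε c1 c2 c3 c4 d23 d24 d34 ?_ ?_ ?_
    (fun y hy => div_nonneg (p2 y hy) hMpos.le) (fun y hy => div_nonneg (p3 y hy) hMpos.le)
    (fun y hy => div_nonneg (p4 y hy) hMpos.le) y2 y3 y4 x0 hy2 hy3 hy4 hx0
    (by simp [v2 y2 hy2]) (by simp [v3 y3 hy3]) (by simp [v4 y4 hy4]) (div_self hMpos.ne')
    (fun x hx => (div_le_one hMpos).2 (mx x hx)) ?_ ?_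
  · intro x hx y hy
    exact nonnbr2 c3 c4 hE hx hy (hdeg x hx y (by simp [hy]))
  · intro x hx y hy
    have := nonnbr2 c2 c4 (partite_swap23 hE) hx hy (hdeg x hx y (by simp [hy]))
    have e : ∀ p : α × α, ({x, p.1, y, p.2} : Finset α) = {x, y, p.1, p.2} := by
      intro p; ext z; simp only [mem_insert, mem_singleton]; tauto
    simpa only [e] using this
  · intro x hx y hy
    have := nonnbr2 c2 c3 (partite_swap23 (partite_swap34 hE)) hx hy (hdeg x hx y (by simp [hy]))
    have e : ∀ p : α × α, ({x, p.1, p.2, y} : Finset α) = {x, y, p.1, p.2} := by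
      intro p; ext z; simp only [mem_insert, mem_singleton]; tauto
    simpa only [e] using this
  · intro x hx a ha b hb d hd he
    have h := hw _ he
    have n1 : x ≠ a := fun h => Finset.disjoint_left.1 d12 hx (h ▸ ha)
    have n2 : x ≠ b := fun h => Finset.disjoint_left.1 d13 hx (h ▸ hb)
    have n3 : x ≠ d := fun h => Finset.disjoint_left.1 d14 hx (h ▸ hd)
    have n4 : a ≠ b := fun h => Finset.disjoint_left.1 d23 ha (h ▸ hb)
    have n5 : a ≠ d := fun h => Finset.disjoint_left.1 d24 ha (h ▸ hd)
    have n6 : b ≠ d := fun h => Finset.disjoint_left.1 d34 hb (h ▸ hd)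
    rw [sum_insert (by simp [n1, n2, n3]), sum_insert (by simp [n4, n5]),
      sum_insert (by simp [n6]), sum_singleton] at h
    rw [← add_div, ← add_div]
    apply div_le_div_of_nonneg_right _ hMpos.le
    rw [v2 a ha, v3 b hb, v4 d hd]
    linarith
  · rw [← sum_div, ← sum_div, ← sum_div, ← sum_div, ← add_div, ← add_div]
    apply div_le_div_of_nonneg_right _ hMpos.le
    linarith

/-- For every sufficiently small `ε > 0` there is `γ0 > 0` such that for every
`γ ∈ (0, γ0)` there is `n0` such that for all `n ≥ n0`: if `H` is a balanced
4-partite 4-graph with classes of size `n`, not `ε`-close to `H'₁,₃(n)`, with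
`d_H({x,y}) ≥ (5/9 − γ)n²` for all `x ∈ V1`, `y ∈ V2 ∪ V3 ∪ V4`, then `H` has
a fractional perfect matching whose support has size at most `4n`. -/
theorem fractional_perfect_matching :
    ∃ ε0 : ℝ, 0 < ε0 ∧ ∀ ε : ℝ, 0 < ε → ε < ε0 →
    ∃ γ0 : ℝ, 0 < γ0 ∧ ∀ γ : ℝ, 0 < γ → γ < γ0 →
    ∃ n0 : ℕ, ∀ n : ℕ, n0 ≤ n →
    ∀ (α : Type) [DecidableEq α], ∀ V1 V2 V3 V4 : Finset α,
      Disjoint V1 V2 → Disjoint V1 V3 → Disjoint V1 V4 →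
      Disjoint V2 V3 → Disjoint V2 V4 → Disjoint V3 V4 →
      V1.card = n → V2.card = n → V3.card = n → V4.card = n →
      ∀ E : Finset (Finset α),
        IsPartite4 V1 V2 V3 V4 E →
        ¬ CloseToH13 ε n V1 V2 V3 V4 E →
        (∀ x ∈ V1, ∀ y ∈ V2 ∪ V3 ∪ V4,
          ((5 : ℝ) / 9 - γ) * n ^ 2 ≤ (hdeg2 E x y : ℝ)) →
        ∃ f : Finset α → ℝ,
          IsFracPM (V1 ∪ V2 ∪ V3 ∪ V4) E f ∧
          {e : Finset α | e ∈ E ∧ 0 < f e}.ncard ≤ 4 * n := by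
  refine ⟨1, one_pos, fun ε hε _ => ?_⟩
  obtain ⟨L0, hL0⟩ := exists_nat_ge (3508/ε)
  obtain ⟨L, hLL, hL⟩ : ∃ L : ℕ, L0 ≤ L ∧ (20000:ℝ) ≤ L :=
    ⟨L0 + 20000, by omega, by push_cast; linarith [Nat.cast_nonneg (α := ℝ) L0]⟩
  have hLpos : (0:ℝ) < L := by linarith
  have hLε : 3508/(L:ℝ) ≤ ε := by
    have h1 : (L0:ℝ) ≤ L := by exact_mod_cast hLL
    have h2 := hL0.trans h1
    rw [div_le_iff₀ hε] at h2
    rw [div_le_iff₀ hLpos]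
    linarith
  refine ⟨1/(5*(L:ℝ)^2), by positivity, fun γ hγ0 hγ => ⟨L, ?_⟩⟩
  intro n hn α _ V1 V2 V3 V4 d12 d13 d14 d23 d24 d34 c1 c2 c3 c4 E hE hclose hdeg
  have hn0 : 0 < n := lt_of_lt_of_le (by exact_mod_cast hLpos) hn
  refine lp_duality (V1 ∪ V2 ∪ V3 ∪ V4) V1 n hn0 ?_ ?_ c1 E (fun e he => ?_) ?_
  · rw [card_union_of_disjoint (by simp [disjoint_union_left, *]),
      card_union_of_disjoint (by simp [disjoint_union_left, *]), card_union_of_disjoint d12]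
    omega
  · intro x hx; simp [hx]
  · exact ⟨(hE e he).1, (hE e he).2.1⟩
  · intro w c hw
    exact no_dual hL hγ0.le hγ.le hn hLε d12 d13 d14 d23 d24 d34 c1 c2 c3 c4 hE hclose hdeg w c hw
end
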